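/- arXiv:2111.08778 — 5 statements merged into one kernel-verified Lean document; each statement's English description precedes it below -/
import Mathlib

section
/- Let p > 3 be a prime. Then the sum over k from 0 to p-1 of binom(2k,k) * (3k+1)/(-16)^k * f_k is congruent to (-1)^((p-1)/2) * p + p^3 * E_{p-3} modulo p^4, where the congruence is understood in the rational numbers (i.e., the p-adic valuation of the difference is at least 4). -/
/-- The Franel numbers `f n = ∑ k ≤ n, (n.choose k)^3`. -/
def franel (n : ℕ) : ℕ := ∑ k ∈ Finset.range (n + 1), (n.choose k) ^ 3
/-- The Euler numbers, defined by the e.g.f. `2 * exp t / (exp (2*t) + 1)`,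
equivalently by `E 0 = 1` and the recurrence coming from `cosh t * sech t = 1`. -/
def eulerNumber : ℕ → ℚ
  | 0 => 1
  | n + 1 => -∑ k ∈ (Finset.range (n + 1)).attach,
      if (n + 1 - k.1) % 2 = 0 then ((n + 1).choose k.1 : ℚ) * eulerNumber k.1 else 0
  decreasing_by exact Finset.mem_range.mp k.2

/-! ### The Franel numbers -/

theorem cast_choose_mul_sub (n k : ℕ) :
    ((n + 1).choose k : ℚ) * ((n : ℚ) + 1 - k) = (n + 1) * (n.choose k : ℚ) := by
  rcases le_or_gt k (n + 1) with h | h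
  · have := Nat.choose_mul_succ_eq n k
    have h2 := congrArg (Nat.cast : ℕ → ℚ) this
    push_cast [Nat.cast_sub h] at h2
    linarith
  · rw [Nat.choose_eq_zero_of_lt h, Nat.choose_eq_zero_of_lt (by lia)]
    simp

theorem cast_choose_succ_mul (n k : ℕ) :
    (n.choose (k + 1) : ℚ) * (k + 1) = (n.choose k : ℚ) * ((n : ℚ) - k) := by
  rcases le_or_gt k n with h | h
  · have h2 := congrArg (Nat.cast : ℕ → ℚ) (Nat.choose_succ_right_eq n k)
    push_cast [Nat.cast_sub h] at h2
    linarith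
  · rw [Nat.choose_eq_zero_of_lt h, Nat.choose_eq_zero_of_lt (by lia)]
    simp

theorem franel_eq_sum_range {n N : ℕ} (h : n < N) :
    (franel n : ℚ) = ∑ k ∈ Finset.range N, (n.choose k : ℚ) ^ 3 := by
  rw [franel]
  push_cast
  refine Finset.sum_subset (by simpa using h) fun k _ hk => ?_
  rw [Nat.choose_eq_zero_of_lt (by simpa using hk)]
  simp

/-- Franel's recurrence. -/
theorem franel_recurrence (n : ℕ) :
    ((n : ℚ) + 2) ^ 2 * franel (n + 2) =
      (7 * (n : ℚ) ^ 2 + 21 * n + 16) * franel (n + 1) + 8 * ((n : ℚ) + 1) ^ 2 * franel n := by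
  rw [franel_eq_sum_range (show n < n + 3 by lia),
    franel_eq_sum_range (show n + 1 < n + 3 by lia),
    franel_eq_sum_range (show n + 2 < n + 3 by lia), ← sub_eq_zero]
  let Q : ℚ → ℚ := fun k => -14 * (n : ℚ) ^ 3 - 74 * (n : ℚ) ^ 2 - 128 * n - 72
    + (27 * (n : ℚ) ^ 2 + 93 * n + 78) * k - (18 * n + 30) * k ^ 2 + 4 * k ^ 3
  let G : ℕ → ℚ := fun k =>
    (k : ℚ) ^ 3 * Q k * ((n + 2).choose k : ℚ) ^ 3 / (((n : ℚ) + 1) * ((n : ℚ) + 2) ^ 3)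
  have hn1 : (n : ℚ) + 1 ≠ 0 := by positivity
  have hn2 : (n : ℚ) + 2 ≠ 0 := by positivity
  have key : ∀ k : ℕ, ((n : ℚ) + 2) ^ 2 * ((n + 2).choose k : ℚ) ^ 3 -
      ((7 * (n : ℚ) ^ 2 + 21 * n + 16) * ((n + 1).choose k : ℚ) ^ 3 +
        8 * ((n : ℚ) + 1) ^ 2 * (n.choose k : ℚ) ^ 3) = G (k + 1) - G k := by
    intro k
    have h1 : ((n + 1).choose k : ℚ) = ((n + 2).choose k : ℚ) * (n + 2 - k) / (n + 2) := by
      rw [eq_div_iff hn2]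
      have := cast_choose_mul_sub (n + 1) k
      push_cast at this
      linear_combination -this
    have h0 : (n.choose k : ℚ) =
        ((n + 2).choose k : ℚ) * (n + 2 - k) / (n + 2) * (n + 1 - k) / (n + 1) := by
      rw [← h1, eq_div_iff hn1]
      linear_combination -cast_choose_mul_sub n k
    have h3 : G (k + 1) = (((n + 2).choose k : ℚ) * (n + 2 - k)) ^ 3 * Q (k + 1) /
        (((n : ℚ) + 1) * ((n : ℚ) + 2) ^ 3) := by
      have h := cast_choose_succ_mul (n + 2) k
      push_cast at h
      simp only [G]
      rw [← h]
      push_cast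
      ring
    rw [h3, h1, h0]
    simp only [G, Q]
    field_simp
    ring
  have hsum := Finset.sum_range_sub G (n + 3)
  rw [← Finset.sum_congr rfl fun k _ => key k] at hsum
  simp only [Finset.sum_sub_distrib, Finset.sum_add_distrib, ← Finset.mul_sum] at hsum
  rw [hsum]
  simp [G]

/-- The summand of the expansion of the Franel numbers in `franel_eq_sum`. -/
def franelTerm (n j : ℕ) : ℚ :=
  ((n + 2 * j).choose (3 * j) : ℚ) * ((2 * j).choose j * (3 * j).choose j) * ((-4) ^ n / (-4) ^ j)

theorem franelTerm_eq_zero {n j : ℕ} (h : n < j) : franelTerm n j = 0 := by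
  simp [franelTerm, Nat.choose_eq_zero_of_lt (show n + 2 * j < 3 * j by lia)]

theorem sum_franelTerm {n N : ℕ} (h : n < N) :
    ∑ j ∈ Finset.range (n + 1), franelTerm n j = ∑ j ∈ Finset.range N, franelTerm n j :=
  Finset.sum_subset (by simpa using h) fun j _ hj => franelTerm_eq_zero (by simpa using hj)

theorem choose_two_mul_choose_three_succ (j : ℕ) :
    (((2 * (j + 1)).choose (j + 1) * (3 * (j + 1)).choose (j + 1) : ℕ) : ℚ) * ((j : ℚ) + 1) ^ 3 =
      ((2 * j).choose j * (3 * j).choose j : ℕ) * ((3 * j + 1) * (3 * j + 2) * (3 * j + 3)) := by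
  have h : ∀ i : ℕ, (((2 * i).choose i * (3 * i).choose i : ℕ) : ℚ) * (i.factorial : ℚ) ^ 3 =
      ((3 * i).factorial : ℚ) := by
    intro i
    have h2 := Nat.add_choose_mul_factorial_mul_factorial i i
    have h3 := Nat.add_choose_mul_factorial_mul_factorial (2 * i) i
    rw [← two_mul] at h2
    rw [show 2 * i + i = 3 * i by ring] at h3
    rw [← h3, ← h2]
    push_cast
    ring
  have h0 := h j
  have h1 := h (j + 1)
  rw [show 3 * (j + 1) = 3 * j + 1 + 1 + 1 by ring] at h1 ⊢
  simp only [Nat.factorial_succ, Nat.cast_mul] at h1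
  rw [← h0] at h1
  have hf : (j.factorial : ℚ) ^ 3 ≠ 0 := by positivity
  apply mul_right_cancel₀ hf
  push_cast at h1 ⊢
  linear_combination h1

theorem choose_add_two_mul_succ (n j : ℕ) :
    ((n + 2 * (j + 1)).choose (3 * (j + 1)) : ℚ) * ((3 * j + 1) * (3 * j + 2) * (3 * j + 3)) =
      ((n + 2 * j).choose (3 * j) : ℚ) * ((n + 2 * j + 1) * (n + 2 * j + 2) * (n - j)) := by
  have e1 := cast_choose_succ_mul (n + 2 * j + 2) (3 * j + 2)
  have e2 := cast_choose_succ_mul (n + 2 * j + 2) (3 * j + 1)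
  have e3 := cast_choose_succ_mul (n + 2 * j + 2) (3 * j)
  have e4 := cast_choose_mul_sub (n + 2 * j + 1) (3 * j)
  have e5 := cast_choose_mul_sub (n + 2 * j) (3 * j)
  rw [show n + 2 * (j + 1) = n + 2 * j + 2 by ring, show 3 * (j + 1) = 3 * j + 2 + 1 by ring]
  push_cast at e1 e2 e3 e4 e5
  linear_combination (3 * j + 1) * (3 * j + 2 : ℚ) * e1 + (3 * j + 1) * (n - j : ℚ) * e2 +
    (n - j) * (n - j + 1 : ℚ) * e3 + (n - j) * (n - j + 1 : ℚ) * e4 +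
    (n - j : ℚ) * (n + 2 * j + 2) * e5

theorem franelTerm_succ_right (n j : ℕ) :
    franelTerm n (j + 1) * (-4 * ((j : ℚ) + 1) ^ 3) =
      franelTerm n j * ((n + 2 * j + 1) * (n + 2 * j + 2) * (n - j)) := by
  have h1 := choose_two_mul_choose_three_succ j
  have h2 := choose_add_two_mul_succ n j
  have h3 : ((3 * j + 1) * (3 * j + 2) * (3 * j + 3) : ℚ) ≠ 0 := by positivity
  apply mul_right_cancel₀ h3
  simp only [franelTerm, pow_succ, ← div_div]
  push_cast at h1
  linear_combination ((n + 2 * (j + 1)).choose (3 * (j + 1)) : ℚ) *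
    ((3 * j + 1) * (3 * j + 2) * (3 * j + 3)) * ((-4) ^ n / (-4) ^ j) * h1 +
    ((2 * j).choose j * (3 * j).choose j : ℚ) * ((3 * j + 1) * (3 * j + 2) * (3 * j + 3)) *
    ((-4) ^ n / (-4) ^ j) * h2

theorem franelTerm_succ_left (n j : ℕ) :
    franelTerm (n + 1) j * ((n : ℚ) + 1 - j) = -4 * (n + 2 * j + 1) * franelTerm n j := by
  have h := cast_choose_mul_sub (n + 2 * j) (3 * j)
  push_cast at h
  simp only [franelTerm, pow_succ]
  rw [show n + 1 + 2 * j = n + 2 * j + 1 by ring]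
  linear_combination ((2 * j).choose j * (3 * j).choose j : ℚ) * ((-4) ^ n * (-4) / (-4) ^ j) * h

theorem sum_franelTerm_recurrence (n : ℕ) :
    ((n : ℚ) + 2) ^ 2 * ∑ j ∈ Finset.range (n + 3), franelTerm (n + 2) j =
      (7 * (n : ℚ) ^ 2 + 21 * n + 16) * ∑ j ∈ Finset.range (n + 2), franelTerm (n + 1) j +
      8 * ((n : ℚ) + 1) ^ 2 * ∑ j ∈ Finset.range (n + 1), franelTerm n j := by
  rw [sum_franelTerm (show n < n + 3 by lia), sum_franelTerm (show n + 1 < n + 3 by lia),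
    ← sub_eq_zero]
  let G : ℕ → ℚ := fun j => -3 * (3 * n + 5) * (j : ℚ) ^ 3 * franelTerm (n + 2) j /
    ((n + 2 * j + 1) * (n + 2 * j + 2))
  have key : ∀ j : ℕ, ((n : ℚ) + 2) ^ 2 * franelTerm (n + 2) j -
      ((7 * (n : ℚ) ^ 2 + 21 * n + 16) * franelTerm (n + 1) j +
        8 * ((n : ℚ) + 1) ^ 2 * franelTerm n j) = G (j + 1) - G j := by
    intro j
    have a1 : (n : ℚ) + 2 * j + 1 ≠ 0 := by positivity
    have a2 : (n : ℚ) + 2 * j + 2 ≠ 0 := by positivity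
    have a3 : (n : ℚ) + 2 * j + 3 ≠ 0 := by positivity
    have a4 : (n : ℚ) + 2 * j + 4 ≠ 0 := by positivity
    have h1 : franelTerm (n + 1) j =
        franelTerm (n + 2) j * (n + 2 - j) / (-4 * (n + 2 * j + 2)) := by
      rw [eq_div_iff (by simpa using a2)]
      have := franelTerm_succ_left (n + 1) j
      push_cast at this
      linear_combination -this
    have h0 : franelTerm n j = franelTerm (n + 2) j * (n + 2 - j) / (-4 * (n + 2 * j + 2)) *
        (n + 1 - j) / (-4 * (n + 2 * j + 1)) := by
      rw [← h1, eq_div_iff (by simpa using a1)]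
      linear_combination -franelTerm_succ_left n j
    have h3 : G (j + 1) = -3 * (3 * n + 5) * (franelTerm (n + 2) j * (n + 2 - j)) / (-4) := by
      have h := franelTerm_succ_right (n + 2) j
      push_cast at h
      have e : G (j + 1) = -3 * (3 * n + 5) * (franelTerm (n + 2) (j + 1) *
          (-4 * ((j : ℚ) + 1) ^ 3)) / (-4 * ((n + 2 * j + 3) * (n + 2 * j + 4))) := by
        simp only [G]
        push_cast
        rw [show (n : ℚ) + 2 * (j + 1) + 1 = n + 2 * j + 3 by ring,
          show (n : ℚ) + 2 * (j + 1) + 2 = n + 2 * j + 4 by ring]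
        field_simp
      rw [e, h]
      field_simp
      ring
    rw [h3, h1, h0]
    simp only [G]
    field_simp
    ring
  have hsum := Finset.sum_range_sub G (n + 3)
  rw [← Finset.sum_congr rfl fun j _ => key j] at hsum
  simp only [Finset.sum_sub_distrib, Finset.sum_add_distrib, ← Finset.mul_sum] at hsum
  rw [hsum]
  simp [G, franelTerm_eq_zero (show n + 2 < n + 3 by lia)]

theorem franel_eq_sum (n : ℕ) :
    (franel n : ℚ) = ∑ j ∈ Finset.range (n + 1), franelTerm n j := by
  induction n using Nat.strong_induction_on with
  | _ n ih =>
    match n with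
    | 0 => simp [franel, franelTerm]
    | 1 =>
      simp [franel, franelTerm, Finset.sum_range_succ]
      norm_num [Nat.choose]
    | n + 2 =>
      have hn2 : ((n : ℚ) + 2) ^ 2 ≠ 0 := by positivity
      apply mul_left_cancel₀ hn2
      rw [franel_recurrence, sum_franelTerm_recurrence, ih n (by lia), ih (n + 1) (by lia)]

/-! ### Reduction to a single hypergeometric sum -/

theorem choose_two_mul_succ (k : ℕ) :
    ((2 * (k + 1)).choose (k + 1) : ℚ) * (k + 1) = 2 * (2 * k + 1) * ((2 * k).choose k : ℚ) := by
  have h := congrArg (Nat.cast : ℕ → ℚ) (Nat.succ_mul_centralBinom_succ k)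
  simp only [Nat.centralBinom_eq_two_mul_choose] at h
  push_cast at h
  linear_combination h

theorem sum_choose_mul_franelTerm (N j : ℕ) :
    ∑ k ∈ Finset.range N, ((2 * k).choose k : ℚ) * (3 * k + 1) / (-16) ^ k * franelTerm k j =
      2 / (2 * j + 1) * (N * (N - j)) * ((2 * N).choose N : ℚ) / (-16) ^ N * franelTerm N j := by
  induction N with
  | zero => simp
  | succ N ih =>
    rw [Finset.sum_range_succ, ih]
    have h1 := choose_two_mul_succ N
    have h2 := franelTerm_succ_left N j
    have hj : (2 * j + 1 : ℚ) ≠ 0 := by positivity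
    have e : 2 / (2 * j + 1) * (((N + 1 : ℕ) : ℚ) * ((N + 1 : ℕ) - j)) *
        ((2 * (N + 1)).choose (N + 1) : ℚ) / (-16) ^ (N + 1) * franelTerm (N + 1) j =
        2 / (2 * j + 1) * (((2 * (N + 1)).choose (N + 1) : ℚ) * (N + 1)) *
          (franelTerm (N + 1) j * (N + 1 - j)) / (-16) ^ N / (-16) := by
      rw [pow_succ, ← div_div]
      push_cast
      ring
    rw [e, h1, h2]
    field_simp
    ring

/-- The terminating hypergeometric term `(1 - x)_j (1 + x)_{2 j} / (4 ^ j (j!) ^ 3)`. -/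
def hyperTerm (x : ℚ) (j : ℕ) : ℚ :=
  ∏ i ∈ Finset.range j, (x + 2 * i + 1) * (x + 2 * i + 2) * (i + 1 - x) / (4 * ((i : ℚ) + 1) ^ 3)

theorem sub_mul_franelTerm (N j : ℕ) :
    ((N : ℚ) - j) * franelTerm N j = N * (-4) ^ N * hyperTerm N j := by
  induction j with
  | zero => simp [franelTerm, hyperTerm]
  | succ j ih =>
    have h := franelTerm_succ_right N j
    have hj : (-4 * ((j : ℚ) + 1) ^ 3) ≠ 0 := by
      have : (j : ℚ) + 1 ≠ 0 := by positivity
      simpa using this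
    rw [hyperTerm, Finset.prod_range_succ, ← hyperTerm]
    rw [← eq_div_iff hj] at h
    rw [h]
    have e : ((N : ℚ) - (j + 1 : ℕ)) *
        (franelTerm N j * ((N + 2 * j + 1) * (N + 2 * j + 2) * (N - j)) / (-4 * ((j : ℚ) + 1) ^ 3)) =
        ((N : ℚ) - (j + 1 : ℕ)) * ((N + 2 * j + 1) * (N + 2 * j + 2)) / (-4 * ((j : ℚ) + 1) ^ 3) *
          ((N - j) * franelTerm N j) := by ring
    rw [e, ih]
    push_cast
    have : (j : ℚ) + 1 ≠ 0 := by positivity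
    field_simp
    ring

theorem sum_choose_mul_franel (N : ℕ) :
    ∑ k ∈ Finset.range N, ((2 * k).choose k : ℚ) * (3 * (k : ℚ) + 1) / (-16) ^ k * (franel k : ℚ) =
      2 * (N : ℚ) ^ 2 * ((2 * N).choose N : ℚ) / 4 ^ N *
        ∑ j ∈ Finset.range N, hyperTerm N j / (2 * j + 1) := by
  have h : ∀ k ∈ Finset.range N,
      ((2 * k).choose k : ℚ) * (3 * (k : ℚ) + 1) / (-16) ^ k * (franel k : ℚ) =
      ∑ j ∈ Finset.range N,
        ((2 * k).choose k : ℚ) * (3 * (k : ℚ) + 1) / (-16) ^ k * franelTerm k j := by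
    intro k hk
    rw [franel_eq_sum, sum_franelTerm (Finset.mem_range.mp hk), Finset.mul_sum]
  rw [Finset.sum_congr rfl h, Finset.sum_comm, Finset.mul_sum]
  refine Finset.sum_congr rfl fun j _ => ?_
  rw [sum_choose_mul_franelTerm]
  have e := sub_mul_franelTerm N j
  have e2 : ((-16 : ℚ)) ^ N = (-4) ^ N * 4 ^ N := by rw [← mul_pow]; norm_num
  have h4 : ((-4 : ℚ)) ^ N ≠ 0 := pow_ne_zero _ (by norm_num)
  calc _ = 2 / (2 * j + 1) * N * ((2 * N).choose N : ℚ) / (-16) ^ N *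
        (((N : ℚ) - j) * franelTerm N j) := by ring
    _ = _ := by
      rw [e, e2]
      field_simp

/-! ### Alternating binomial sums -/

/-- The generalized harmonic number of order two. -/
def harmonicSq (n : ℕ) : ℚ := ∑ i ∈ Finset.range n, 1 / ((i : ℚ) + 1) ^ 2

/-- The alternating harmonic number of order two. -/
def altHarmonicSq (n : ℕ) : ℚ := ∑ i ∈ Finset.range n, (-1) ^ (i + 1) / ((i : ℚ) + 1) ^ 2

theorem sum_alternating_choose_succ (n : ℕ) :
    ∑ r ∈ Finset.range (n + 1), (-1 : ℚ) ^ (r + 1) * ((n + 1).choose (r + 1) : ℚ) = -1 := by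
  have h := Int.alternating_sum_range_choose_of_ne (n := n + 1) (by simp)
  rw [Finset.sum_range_succ'] at h
  have h2 := congrArg (Int.cast : ℤ → ℚ) h
  push_cast at h2
  simp only [Nat.choose_zero_right, Nat.cast_one, mul_one] at h2
  linarith

theorem cast_choose_succ_sub (n r : ℕ) :
    ((n + 1).choose (r + 1) : ℚ) - (n.choose (r + 1) : ℚ) =
      ((n + 1).choose (r + 1) : ℚ) * (r + 1) / (n + 1) := by
  have h := cast_choose_mul_sub n (r + 1)
  push_cast at h
  field_simp
  linear_combination h

theorem sum_alternating_choose_div_succ (x : ℕ → ℚ) (n : ℕ) :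
    ∑ r ∈ Finset.range (n + 1), (-1 : ℚ) ^ (r + 1) * ((n + 1).choose (r + 1) : ℚ) / (r + 1) * x r =
      ∑ r ∈ Finset.range n, (-1 : ℚ) ^ (r + 1) * (n.choose (r + 1) : ℚ) / (r + 1) * x r +
      1 / (n + 1) *
        ∑ r ∈ Finset.range (n + 1), (-1 : ℚ) ^ (r + 1) * ((n + 1).choose (r + 1) : ℚ) * x r := by
  have h0 : ∑ r ∈ Finset.range n, (-1 : ℚ) ^ (r + 1) * (n.choose (r + 1) : ℚ) / (r + 1) * x r =
      ∑ r ∈ Finset.range (n + 1), (-1 : ℚ) ^ (r + 1) * (n.choose (r + 1) : ℚ) / (r + 1) * x r := by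
    simp [Finset.sum_range_succ _ n]
  rw [h0, Finset.mul_sum, ← Finset.sum_add_distrib]
  refine Finset.sum_congr rfl fun r _ => ?_
  have h := cast_choose_succ_sub n r
  rw [sub_eq_iff_eq_add] at h
  rw [div_mul_eq_mul_div, div_mul_eq_mul_div]
  nth_rw 1 [h]
  field_simp
  ring

theorem sum_alternating_choose_div (n : ℕ) :
    ∑ r ∈ Finset.range n, (-1 : ℚ) ^ (r + 1) * (n.choose (r + 1) : ℚ) / (r + 1) = -harmonic n := by
  induction n with
  | zero => simp
  | succ n ih =>
    have h := sum_alternating_choose_div_succ (fun _ => 1) n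
    simp only [mul_one] at h
    rw [h, ih, sum_alternating_choose_succ, harmonic_succ]
    push_cast
    ring

theorem sum_alternating_choose_div_sq (n : ℕ) :
    ∑ r ∈ Finset.range n, (-1 : ℚ) ^ (r + 1) * (n.choose (r + 1) : ℚ) / (r + 1) * (1 / (r + 1)) =
      -(harmonic n ^ 2 + harmonicSq n) / 2 := by
  induction n with
  | zero => simp [harmonicSq]
  | succ n ih =>
    rw [sum_alternating_choose_div_succ (fun r => 1 / ((r : ℚ) + 1)) n, ih]
    have h := sum_alternating_choose_div (n + 1)
    simp only [mul_one_div]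
    rw [h, harmonic_succ, harmonicSq, harmonicSq, Finset.sum_range_succ]
    push_cast
    field_simp
    ring

theorem sum_alternating_choose_mul_harmonic (n : ℕ) :
    ∑ r ∈ Finset.range (n + 1), (-1 : ℚ) ^ (r + 1) * ((n + 1).choose (r + 1) : ℚ) *
      harmonic (r + 1) = -1 / (n + 1) := by
  have h1 : ∑ r ∈ Finset.range (n + 1), (-1 : ℚ) ^ (r + 1) * ((n + 1).choose (r + 1) : ℚ) *
      harmonic (r + 1) = ∑ r ∈ Finset.range (n + 1), (-1 : ℚ) ^ r * (n.choose r : ℚ) *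
        (harmonic r - harmonic (r + 1)) := by
    have e1 : ∑ r ∈ Finset.range (n + 1), (-1 : ℚ) ^ r * (n.choose r : ℚ) * harmonic r =
        ∑ r ∈ Finset.range (n + 1),
          (-1 : ℚ) ^ (r + 1) * (n.choose (r + 1) : ℚ) * harmonic (r + 1) := by
      rw [Finset.sum_range_succ' _ n, Finset.sum_range_succ _ n]
      simp
    simp only [mul_sub, Finset.sum_sub_distrib]
    rw [e1, ← Finset.sum_sub_distrib]
    refine Finset.sum_congr rfl fun r _ => ?_
    rw [Nat.choose_succ_succ]
    push_cast
    ring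
  rw [h1]
  have h2 := sum_alternating_choose_succ n
  have h3 : ∀ r ∈ Finset.range (n + 1), (-1 : ℚ) ^ r * (n.choose r : ℚ) *
        (harmonic r - harmonic (r + 1)) =
      (-1 : ℚ) ^ (r + 1) * ((n + 1).choose (r + 1) : ℚ) * (1 / (n + 1)) := by
    intro r _
    have h := congrArg (Nat.cast : ℕ → ℚ) (Nat.add_one_mul_choose_eq n r)
    push_cast at h
    rw [harmonic_succ]
    push_cast
    field_simp
    linear_combination (-1 : ℚ) ^ (r + 1) * h
  rw [Finset.sum_congr rfl h3, ← Finset.sum_mul, h2]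
  ring

theorem sum_alternating_choose_div_mul_harmonic (n : ℕ) :
    ∑ r ∈ Finset.range n, (-1 : ℚ) ^ (r + 1) * (n.choose (r + 1) : ℚ) / (r + 1) *
      harmonic (r + 1) = -harmonicSq n := by
  induction n with
  | zero => simp [harmonicSq]
  | succ n ih =>
    rw [sum_alternating_choose_div_succ (fun r => harmonic (r + 1)) n, ih,
      sum_alternating_choose_mul_harmonic, harmonicSq, harmonicSq, Finset.sum_range_succ]
    field_simp
    ring

theorem sum_alternating_choose_mul_harmonic_sub (n : ℕ) :
    ∑ r ∈ Finset.range (n + 1), (-1 : ℚ) ^ (r + 1) * ((n + 1).choose (r + 1) : ℚ) *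
      harmonic (n - r) = (-1) ^ n / (n + 1) - harmonic (n + 1) := by
  have h := sum_alternating_choose_mul_harmonic n
  have h2 : ∑ r ∈ Finset.range (n + 1 + 1), (-1 : ℚ) ^ r * ((n + 1).choose r : ℚ) *
      harmonic r = -1 / (n + 1) := by
    rw [Finset.sum_range_succ', h]
    simp
  have h3 : ∑ r ∈ Finset.range (n + 1 + 1), (-1 : ℚ) ^ r * ((n + 1).choose r : ℚ) *
      harmonic (n + 1 - r) = (-1) ^ n / (n + 1) := by
    have e : ∀ r ∈ Finset.range (n + 1 + 1), (-1 : ℚ) ^ (n + 1 + 1 - 1 - r) *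
        ((n + 1).choose (n + 1 + 1 - 1 - r) : ℚ) * harmonic (n + 1 - (n + 1 + 1 - 1 - r)) =
        (-1) ^ (n + 1) * ((-1 : ℚ) ^ r * ((n + 1).choose r : ℚ) * harmonic r) := by
      intro r hr
      obtain ⟨k, hk⟩ : ∃ k, n + 1 = r + k := ⟨n + 1 - r, by
        have := Finset.mem_range.mp hr
        lia⟩
      rw [Nat.add_sub_cancel, Nat.choose_symm (by lia), hk, Nat.add_sub_cancel_left,
        Nat.add_sub_cancel, pow_add]
      have : ((-1 : ℚ) ^ r) * (-1) ^ r = 1 := by rw [← mul_pow]; simp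
      linear_combination -(-1 : ℚ) ^ k * ((r + k).choose r : ℚ) * harmonic r * this
    rw [← Finset.sum_range_reflect, Finset.sum_congr rfl e, ← Finset.mul_sum, h2, pow_succ]
    ring
  rw [Finset.sum_range_succ'] at h3
  simp only [Nat.add_sub_add_right] at h3
  simp only [pow_zero, Nat.choose_zero_right, Nat.cast_one, mul_one, one_mul, Nat.sub_zero] at h3
  linarith

theorem sum_alternating_choose_div_mul_harmonic_sub (n : ℕ) :
    ∑ r ∈ Finset.range n, (-1 : ℚ) ^ (r + 1) * (n.choose (r + 1) : ℚ) / (r + 1) *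
      (harmonic n - harmonic (n - (r + 1))) = harmonicSq n + 2 * altHarmonicSq n := by
  induction n with
  | zero => simp [harmonicSq, altHarmonicSq]
  | succ n ih =>
    let U : ℕ → ℚ := fun r => (-1 : ℚ) ^ (r + 1) * ((n + 1).choose (r + 1) : ℚ)
    have h : ∀ r ∈ Finset.range n, (-1 : ℚ) ^ (r + 1) * ((n + 1).choose (r + 1) : ℚ) / (r + 1) *
        (harmonic (n + 1) - harmonic (n + 1 - (r + 1))) =
        (-1 : ℚ) ^ (r + 1) * (n.choose (r + 1) : ℚ) / (r + 1) *
          (harmonic n - harmonic (n - (r + 1))) +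
        (U r * (harmonic (n + 1) / (n + 1) - 1 / (n + 1) ^ 2) -
          1 / (n + 1) * (U r * harmonic (n - r))) := by
      intro r hr
      obtain ⟨k, rfl⟩ : ∃ k, n = r + 1 + k := ⟨n - (r + 1), by
        have := Finset.mem_range.mp hr
        lia⟩
      have h1 := cast_choose_mul_sub (r + 1 + k) (r + 1)
      rw [show r + 1 + k + 1 - (r + 1) = k + 1 by lia, show r + 1 + k - (r + 1) = k by lia,
        show r + 1 + k - r = k + 1 by lia, harmonic_succ, harmonic_succ k]
      simp only [U]
      push_cast at h1 ⊢
      have hd : (r : ℚ) + 1 + k + 1 ≠ 0 := by positivity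
      have h2 : ((r + 1 + k).choose (r + 1) : ℚ) =
          ((r + 1 + k + 1).choose (r + 1) : ℚ) * (k + 1) / (r + 1 + k + 1) := by
        rw [eq_div_iff hd]
        linear_combination -h1
      rw [h2]
      field_simp
      ring
    have hU := sum_alternating_choose_succ n
    have hH := sum_alternating_choose_mul_harmonic_sub n
    rw [Finset.sum_range_succ] at hU hH
    rw [Finset.sum_range_succ, Finset.sum_congr rfl h, Finset.sum_add_distrib, ih,
      Finset.sum_sub_distrib, ← Finset.mul_sum, ← Finset.sum_mul, eq_sub_of_add_eq hU,
      eq_sub_of_add_eq hH, harmonicSq, harmonicSq, altHarmonicSq, altHarmonicSq,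
      Finset.sum_range_succ _ n, Finset.sum_range_succ _ n]
    simp only [Nat.choose_self, Nat.sub_self, harmonic_zero]
    rw [pow_succ]
    push_cast
    field_simp
    ring

theorem sum_alternating_inv_choose (n : ℕ) :
    ∑ s ∈ Finset.range (n + 1), (-1 : ℚ) ^ s / (n.choose s : ℚ) =
      (1 + (-1) ^ n) * (n + 1) / (n + 2) := by
  have h : ∀ s ∈ Finset.range (n + 1), (-1 : ℚ) ^ s / (n.choose s : ℚ) =
      ((n : ℚ) + 1) / (n + 2) * ((-1) ^ s / ((n + 1).choose s : ℚ) -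
        (-1) ^ (s + 1) / ((n + 1).choose (s + 1) : ℚ)) := by
    intro s hs
    have hs' : s ≤ n := by simpa [Nat.lt_succ_iff] using hs
    have c0 : (n.choose s : ℚ) ≠ 0 := by exact_mod_cast (Nat.choose_pos hs').ne'
    have h1 := cast_choose_mul_sub n s
    have h2 := congrArg (Nat.cast : ℕ → ℚ) (Nat.add_one_mul_choose_eq n s)
    push_cast at h2
    have hd : (n : ℚ) + 1 - s ≠ 0 := by
      have : (s : ℚ) ≤ n := by exact_mod_cast hs'
      linarith
    have hs1 : (s : ℚ) + 1 ≠ 0 := by positivity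
    have hn1 : (n : ℚ) + 1 ≠ 0 := by positivity
    rw [← eq_div_iff hd] at h1
    rw [eq_comm, ← eq_div_iff hs1] at h2
    rw [h1, h2]
    field_simp
    ring
  rw [Finset.sum_congr rfl h, ← Finset.mul_sum, Finset.sum_range_sub']
  simp
  ring

theorem sum_alternating_inv_sq_mul_choose (n : ℕ) :
    ∑ r ∈ Finset.range n, (-1 : ℚ) ^ (r + 1) / ((r + 1) ^ 2 * (n.choose (r + 1) : ℚ)) =
      harmonicSq n + 2 * altHarmonicSq n := by
  induction n with
  | zero => simp [harmonicSq, altHarmonicSq]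
  | succ n ih =>
    have h : ∀ r ∈ Finset.range n,
        (-1 : ℚ) ^ (r + 1) / ((r + 1) ^ 2 * ((n + 1).choose (r + 1) : ℚ)) =
        (-1 : ℚ) ^ (r + 1) / ((r + 1) ^ 2 * (n.choose (r + 1) : ℚ)) +
        1 / (n * (n + 1)) * ((-1 : ℚ) ^ r / ((n - 1).choose r : ℚ)) := by
      intro r hr
      have hr' : r < n := by simpa using hr
      obtain ⟨k, rfl⟩ : ∃ k, n = k + 1 := ⟨n - 1, by lia⟩
      have c0 : (k.choose r : ℚ) ≠ 0 := by exact_mod_cast (Nat.choose_pos (by lia)).ne'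
      have h1 := cast_choose_mul_sub (k + 1) (r + 1)
      have h2 := congrArg (Nat.cast : ℕ → ℚ) (Nat.add_one_mul_choose_eq k r)
      push_cast at h1 h2
      have hd : (k : ℚ) + 1 + 1 - (r + 1) ≠ 0 := by
        have : (r : ℚ) + 1 ≤ k + 1 := by exact_mod_cast hr'
        linarith
      have hs1 : (r : ℚ) + 1 ≠ 0 := by positivity
      have hk1 : (k : ℚ) + 1 ≠ 0 := by positivity
      have hk2 : (k : ℚ) + 1 + 1 ≠ 0 := by positivity
      rw [← eq_div_iff hd] at h1
      rw [eq_comm, ← eq_div_iff hs1] at h2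
      rw [h1, h2]
      push_cast
      field_simp
      ring
    rw [Finset.sum_range_succ, Finset.sum_congr rfl h, Finset.sum_add_distrib, ih,
      ← Finset.mul_sum]
    rcases n with _ | k
    · norm_num [harmonicSq, altHarmonicSq]
    · have := sum_alternating_inv_choose k
      simp only [Nat.add_sub_cancel]
      rw [this, harmonicSq, harmonicSq, altHarmonicSq, altHarmonicSq, Finset.sum_range_succ _ (k + 1),
        Finset.sum_range_succ _ (k + 1)]
      push_cast
      simp only [Nat.choose_self, pow_succ]
      field_simp
      ring

/-! ### Euler numbers -/

theorem eulerNumber_succ (n : ℕ) :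
    eulerNumber (n + 1) = -∑ k ∈ Finset.range (n + 1),
      if (n + 1 - k) % 2 = 0 then ((n + 1).choose k : ℚ) * eulerNumber k else 0 := by
  rw [eulerNumber, Finset.sum_attach (Finset.range (n + 1)) fun k =>
    if (n + 1 - k) % 2 = 0 then ((n + 1).choose k : ℚ) * eulerNumber k else 0]

theorem eulerNumber_eq_zero_of_odd {n : ℕ} (hn : Odd n) : eulerNumber n = 0 := by
  induction n using Nat.strong_induction_on with
  | _ n ih =>
    obtain ⟨m, rfl⟩ := hn
    rw [eulerNumber_succ, neg_eq_zero]
    refine Finset.sum_eq_zero fun k hk => ?_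
    have hk' := Finset.mem_range.mp hk
    split_ifs with h
    · rw [ih k hk' (by rw [Nat.odd_iff]; lia), mul_zero]
    · rfl

theorem eulerNumber_eq_intCast (n : ℕ) : ∃ z : ℤ, eulerNumber n = z := by
  induction n using Nat.strong_induction_on with
  | _ n ih =>
    match n with
    | 0 => exact ⟨1, by simp [eulerNumber]⟩
    | n + 1 =>
      rw [eulerNumber_succ]
      have : ∀ k : ℕ, ∃ z : ℤ, k ∈ Finset.range (n + 1) →
          (if (n + 1 - k) % 2 = 0 then ((n + 1).choose k : ℚ) * eulerNumber k else 0) = z := by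
        intro k
        by_cases hk : k ∈ Finset.range (n + 1)
        · obtain ⟨z, hz⟩ := ih k (Finset.mem_range.mp hk)
          refine ⟨if (n + 1 - k) % 2 = 0 then (n + 1).choose k * z else 0, fun _ => ?_⟩
          split_ifs <;> simp [hz]
        · exact ⟨0, fun h => absurd h hk⟩
      choose z hz using this
      exact ⟨-∑ k ∈ Finset.range (n + 1), z k, by push_cast; rw [Finset.sum_congr rfl hz]⟩

open Polynomial in
/-- The umbral evaluation `X ^ n ↦ E_n`. -/
noncomputable def eulerUmbra : ℚ[X] →ₗ[ℚ] ℚ :=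
  Polynomial.lsum fun n => eulerNumber n • LinearMap.id

open Polynomial in
theorem eulerUmbra_C_mul_X_pow (a : ℚ) (n : ℕ) :
    eulerUmbra (C a * X ^ n) = a * eulerNumber n := by
  rw [eulerUmbra, Polynomial.lsum_apply, C_mul_X_pow_eq_monomial,
    Polynomial.sum_monomial_index _ _ (by simp)]
  simp [mul_comm]

open Polynomial in
theorem eulerUmbra_X_add_C_pow (x : ℚ) (n : ℕ) :
    eulerUmbra ((X + C x) ^ n) =
      ∑ k ∈ Finset.range (n + 1), x ^ (n - k) * (n.choose k : ℚ) * eulerNumber k := by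
  rw [add_pow, map_sum]
  refine Finset.sum_congr rfl fun k _ => ?_
  rw [← eulerUmbra_C_mul_X_pow]
  congr 1
  simp only [map_mul, map_pow, map_natCast]
  ring

theorem one_pow_add_neg_one_pow (n : ℕ) :
    (1 : ℚ) ^ n + (-1) ^ n = if n % 2 = 0 then 2 else 0 := by
  split_ifs with h
  · rw [Even.neg_one_pow (Nat.even_iff.mpr h)]; norm_num
  · rw [Odd.neg_one_pow (Nat.odd_iff.mpr (by lia))]; norm_num

open Polynomial in
theorem eulerUmbra_shift_pow (n : ℕ) :
    eulerUmbra ((X + C 1) ^ n) + eulerUmbra ((X + C (-1)) ^ n) = 2 * (0 : ℚ) ^ n := by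
  rw [eulerUmbra_X_add_C_pow, eulerUmbra_X_add_C_pow, ← Finset.sum_add_distrib]
  simp only [← add_mul, one_pow_add_neg_one_pow]
  cases n with
  | zero => simp [eulerNumber]
  | succ n =>
    rw [Finset.sum_range_succ, eulerNumber_succ]
    simp only [Nat.sub_self, Nat.choose_self, Nat.zero_mod, if_true, mul_neg, Finset.mul_sum]
    rw [← sub_eq_add_neg, ← Finset.sum_sub_distrib]
    simp only [ne_eq, Nat.add_eq_zero_iff, one_ne_zero, and_false, not_false_eq_true, zero_pow,
      mul_zero]
    refine Finset.sum_eq_zero fun k _ => ?_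
    split_ifs <;> simp [mul_assoc]

open Polynomial in
theorem eulerUmbra_shift (f : ℚ[X]) :
    eulerUmbra (f.comp (X + C 1)) + eulerUmbra (f.comp (X + C (-1))) = 2 * f.eval 0 := by
  induction f using Polynomial.induction_on' with
  | add f g hf hg =>
    simp only [add_comp, map_add, eval_add]
    linear_combination hf + hg
  | monomial n a =>
    rw [← C_mul_X_pow_eq_monomial]
    simp only [mul_comp, C_comp, pow_comp, X_comp, eval_mul, eval_C, eval_pow, eval_X]
    simp only [← smul_eq_C_mul, map_smul, smul_eq_mul]
    linear_combination a * eulerUmbra_shift_pow n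

open Polynomial in
theorem eulerUmbra_comp_neg (f : ℚ[X]) : eulerUmbra (f.comp (-X)) = eulerUmbra f := by
  induction f using Polynomial.induction_on' with
  | add f g hf hg => simp only [add_comp, map_add, hf, hg]
  | monomial n a =>
    rw [← C_mul_X_pow_eq_monomial]
    simp only [mul_comp, C_comp, pow_comp, X_comp]
    rcases Nat.even_or_odd n with h | h
    · rw [h.neg_pow]
    · rw [h.neg_pow, mul_neg, map_neg, eulerUmbra_C_mul_X_pow, eulerNumber_eq_zero_of_odd h]
      simp

/-- The polynomial `∑ k, C(n, k) E_k x ^ (n - k)`. -/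
def eulerPoly (n : ℕ) (x : ℚ) : ℚ :=
  ∑ k ∈ Finset.range (n + 1), x ^ (n - k) * (n.choose k : ℚ) * eulerNumber k

open Polynomial in
theorem eulerPoly_add_one_add_sub_one (n : ℕ) (x : ℚ) :
    eulerPoly n (x + 1) + eulerPoly n (x - 1) = 2 * x ^ n := by
  have h := eulerUmbra_shift ((X + C x) ^ n)
  simp only [pow_comp, add_comp, X_comp, C_comp, add_assoc, ← C_add] at h
  rw [eulerUmbra_X_add_C_pow, eulerUmbra_X_add_C_pow] at h
  simp only [eval_pow, eval_add, eval_X, eval_C, zero_add] at h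
  rw [← h, eulerPoly, eulerPoly]
  ring_nf

open Polynomial in
theorem eulerPoly_neg {n : ℕ} (hn : Even n) (x : ℚ) : eulerPoly n (-x) = eulerPoly n x := by
  have h := eulerUmbra_comp_neg ((X + C x) ^ n)
  simp only [pow_comp, add_comp, X_comp, C_comp] at h
  rw [← hn.neg_pow, neg_add, neg_neg, ← C_neg, eulerUmbra_X_add_C_pow, eulerUmbra_X_add_C_pow] at h
  exact h

theorem sum_alternating_even_pow {n : ℕ} (hn : Even n) (hn0 : n ≠ 0) (m : ℕ) :
    ∑ i ∈ Finset.range m, (-1 : ℚ) ^ (i + 1) * (2 * (2 * ((i : ℚ) + 1)) ^ n) =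
      (-1) ^ m * eulerPoly n (2 * m + 1) := by
  have h1 : eulerPoly n 1 = 0 := by
    have h := eulerPoly_add_one_add_sub_one n 0
    rw [zero_add, zero_sub, eulerPoly_neg hn, zero_pow hn0] at h
    linarith
  induction m with
  | zero => simp [h1]
  | succ m ih =>
    rw [Finset.sum_range_succ, ih, ← eulerPoly_add_one_add_sub_one, pow_succ]
    push_cast
    rw [show 2 * ((m : ℚ) + 1) - 1 = 2 * m + 1 by ring]
    ring

/-! ### Congruences between rational numbers -/

/-- The subring of rational numbers whose denominator is coprime to `p`. -/
def pIntegral (p : ℕ) : Subring ℚ where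
  carrier := {x | p.Coprime x.den}
  mul_mem' {x y} hx hy :=
    (Nat.Coprime.mul_right hx hy).coprime_dvd_right (Rat.mul_den_dvd x y)
  one_mem' := by simp
  add_mem' {x y} hx hy :=
    (Nat.Coprime.mul_right hx hy).coprime_dvd_right (Rat.add_den_dvd x y)
  zero_mem' := by simp
  neg_mem' {x} hx := by simpa using hx

theorem inv_intCast_mem_pIntegral {p : ℕ} {z : ℤ} (h : IsCoprime (p : ℤ) z) :
    (z : ℚ)⁻¹ ∈ pIntegral p := by
  change p.Coprime _
  have hc : p.Coprime z.natAbs := by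
    simpa [Int.isCoprime_iff_gcd_eq_one, Int.gcd] using h
  rw [Rat.inv_intCast_den]
  split_ifs with h0
  · exact Nat.coprime_one_right p
  · exact hc

/-- Congruence of rational numbers modulo `p ^ n`. -/
def PCong (p n : ℕ) (x y : ℚ) : Prop := ∃ z ∈ pIntegral p, x - y = (p : ℚ) ^ n * z

namespace PCong

variable {p n : ℕ} {x y z x' y' c : ℚ}

theorem refl (x : ℚ) : PCong p n x x := ⟨0, zero_mem _, by simp⟩

theorem of_eq (h : x = y) : PCong p n x y := h ▸ refl x

theorem symm (h : PCong p n x y) : PCong p n y x := by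
  obtain ⟨z, hz, e⟩ := h
  exact ⟨-z, neg_mem hz, by linear_combination -e⟩

theorem trans (h : PCong p n x y) (h' : PCong p n y z) : PCong p n x z := by
  obtain ⟨u, hu, e⟩ := h
  obtain ⟨v, hv, e'⟩ := h'
  exact ⟨u + v, add_mem hu hv, by linear_combination e + e'⟩

theorem add (h : PCong p n x y) (h' : PCong p n x' y') : PCong p n (x + x') (y + y') := by
  obtain ⟨u, hu, e⟩ := h
  obtain ⟨v, hv, e'⟩ := h'
  exact ⟨u + v, add_mem hu hv, by linear_combination e + e'⟩

theorem mul_left (hc : c ∈ pIntegral p) (h : PCong p n x y) : PCong p n (c * x) (c * y) := by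
  obtain ⟨u, hu, e⟩ := h
  exact ⟨c * u, mul_mem hc hu, by linear_combination c * e⟩

theorem mul_right (hc : c ∈ pIntegral p) (h : PCong p n x y) : PCong p n (x * c) (y * c) := by
  simpa only [mul_comm] using mul_left hc h

theorem mul (h : PCong p n x y) (h' : PCong p n x' y') (hy : y ∈ pIntegral p)
    (hx' : x' ∈ pIntegral p) : PCong p n (x * x') (y * y') :=
  (mul_right hx' h).trans (mul_left hy h')

theorem sum {ι : Type*} {s : Finset ι} {f g : ι → ℚ} (h : ∀ i ∈ s, PCong p n (f i) (g i)) :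
    PCong p n (∑ i ∈ s, f i) (∑ i ∈ s, g i) := by
  classical
  induction s using Finset.induction_on with
  | empty => exact refl _
  | insert a s ha ih =>
    rw [Finset.sum_insert ha, Finset.sum_insert ha]
    exact (h a (Finset.mem_insert_self a s)).add
      (ih fun i hi => h i (Finset.mem_insert_of_mem hi))

theorem prime_pow_mul (k : ℕ) (h : PCong p n x y) :
    PCong p (n + k) ((p : ℚ) ^ k * x) ((p : ℚ) ^ k * y) := by
  obtain ⟨u, hu, e⟩ := h
  exact ⟨u, hu, by rw [pow_add]; linear_combination (p : ℚ) ^ k * e⟩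

theorem of_le {k : ℕ} (hk : k ≤ n) (h : PCong p n x y) : PCong p k x y := by
  obtain ⟨u, hu, e⟩ := h
  obtain ⟨d, rfl⟩ := Nat.exists_eq_add_of_le hk
  exact ⟨(p : ℚ) ^ d * u, mul_mem (pow_mem (natCast_mem _ p) d) hu, by rw [e, pow_add]; ring⟩

theorem mem_pIntegral (h : PCong p n x y) (hy : y ∈ pIntegral p) : x ∈ pIntegral p := by
  obtain ⟨u, hu, e⟩ := h
  rw [sub_eq_iff_eq_add] at e
  rw [e]
  exact add_mem (mul_mem (pow_mem (natCast_mem _ p) n) hu) hy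

theorem mul_right_cancel (hc : c⁻¹ ∈ pIntegral p) (hc0 : c ≠ 0) (h : PCong p n (x * c) (y * c)) :
    PCong p n x y := by
  simpa [hc0] using mul_right hc h

theorem dvd_num (h : PCong p n x y) : (p : ℤ) ^ n ∣ (x - y).num := by
  obtain ⟨z, hz, e⟩ := h
  rw [e]
  have h1 : (((p : ℚ) ^ n * z).num : ℚ) * z.den =
      (p : ℚ) ^ n * z.num * ((p : ℚ) ^ n * z).den := by
    have a := Rat.num_div_den z
    have b := Rat.num_div_den ((p : ℚ) ^ n * z)
    have hz0 : (z.den : ℚ) ≠ 0 := by simp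
    have hd0 : (((p : ℚ) ^ n * z).den : ℚ) ≠ 0 := by simp
    rw [div_eq_iff hz0] at a
    rw [div_eq_iff hd0] at b
    rw [b, a]
    ring
  have h2 : ((p : ℚ) ^ n * z).num * z.den =
      (p : ℤ) ^ n * (z.num * ((p : ℚ) ^ n * z).den) := by
    have : ((p : ℚ) ^ n * z).num * z.den =
      (p : ℤ) ^ n * z.num * ((p : ℚ) ^ n * z).den := by exact_mod_cast h1
    rw [this, mul_assoc]
  have hc : IsCoprime ((p : ℤ) ^ n) (z.den : ℤ) :=
    IsCoprime.pow_left (Nat.isCoprime_iff_coprime.mpr hz)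
  exact hc.dvd_of_dvd_mul_right ⟨_, h2⟩

end PCong

theorem isCoprime_add_mul {p : ℕ} (hp : p.Prime) {r : ℕ} (h0 : 0 < r) (hr : r < p) (c : ℤ) :
    IsCoprime (p : ℤ) (r + c * p) := by
  rw [IsCoprime.add_mul_right_right_iff]
  exact Nat.isCoprime_iff_coprime.mpr
    ((Nat.Prime.coprime_iff_not_dvd hp).mpr (Nat.not_dvd_of_pos_of_lt h0 hr))

theorem inv_mem_pIntegral {p : ℕ} (hp : p.Prime) {r : ℕ} (h0 : 0 < r) (hr : r < p) (c : ℤ)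
    {x : ℚ} (hx : x = r + c * p) : x⁻¹ ∈ pIntegral p := by
  have := inv_intCast_mem_pIntegral (isCoprime_add_mul hp h0 hr c)
  push_cast at this
  rwa [hx]

theorem ne_zero_of_eq_add_mul {p : ℕ} (hp : p.Prime) {r : ℕ} (h0 : 0 < r) (hr : r < p) (c : ℤ)
    {x : ℚ} (hx : x = r + c * p) : x ≠ 0 := by
  have h : ((r : ℤ) + c * p) ≠ 0 := by
    intro h
    have hc := isCoprime_add_mul hp h0 hr c
    rw [h, isCoprime_zero_right, Int.isUnit_iff] at hc
    have := hp.two_le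
    lia
  rw [hx]
  exact_mod_cast h

theorem inv_succ_mem_pIntegral {p : ℕ} (hp : p.Prime) {i : ℕ} (hi : i + 1 < p) :
    ((i : ℚ) + 1)⁻¹ ∈ pIntegral p :=
  inv_mem_pIntegral hp (Nat.succ_pos i) hi 0 (by simp)

theorem inv_two_mem_pIntegral {p : ℕ} (hp : p.Prime) (h : 2 < p) : (2 : ℚ)⁻¹ ∈ pIntegral p :=
  inv_mem_pIntegral hp (r := 2) (by simp) h 0 (by simp)

theorem harmonic_mem_pIntegral {p : ℕ} (hp : p.Prime) {n : ℕ} (hn : n < p) :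
    harmonic n ∈ pIntegral p := by
  refine sum_mem fun i hi => ?_
  have := Finset.mem_range.mp hi
  have h := inv_succ_mem_pIntegral hp (show i + 1 < p by lia)
  exact_mod_cast h

theorem harmonicSq_mem_pIntegral {p : ℕ} (hp : p.Prime) {n : ℕ} (hn : n < p) :
    harmonicSq n ∈ pIntegral p := by
  refine sum_mem fun i hi => ?_
  have := Finset.mem_range.mp hi
  have h := inv_succ_mem_pIntegral hp (show i + 1 < p by lia)
  rw [one_div, ← inv_pow]
  exact pow_mem h 2

/-- Second order expansion of `∏ (1 - c p / i)`. -/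
theorem prod_one_sub_cong {p : ℕ} (hp : p.Prime) (hp2 : 2 < p) {c : ℚ} (hc : c ∈ pIntegral p)
    {n : ℕ} (hn : n < p) :
    PCong p 3 (∏ i ∈ Finset.range n, (1 - c * p / ((i : ℚ) + 1)))
      (1 - c * p * harmonic n + c ^ 2 * (p : ℚ) ^ 2 * (harmonic n ^ 2 - harmonicSq n) / 2) := by
  induction n with
  | zero => exact PCong.of_eq (by simp [harmonicSq])
  | succ n ih =>
    have hi := inv_succ_mem_pIntegral hp hn
    have hpm : (p : ℚ) ∈ pIntegral p := natCast_mem _ p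
    have hH := harmonic_mem_pIntegral hp (show n < p by lia)
    have hH2 := harmonicSq_mem_pIntegral hp (show n < p by lia)
    have h2 := inv_two_mem_pIntegral hp hp2
    rw [Finset.prod_range_succ]
    have hf : 1 - c * p / ((n : ℚ) + 1) ∈ pIntegral p := by
      rw [div_eq_mul_inv]
      exact sub_mem (one_mem _) (mul_mem (mul_mem hc hpm) hi)
    refine ((ih (by lia)).mul_right hf).trans
      ⟨-c ^ 3 * (harmonic n ^ 2 - harmonicSq n) * 2⁻¹ * ((n : ℚ) + 1)⁻¹,
        mul_mem (mul_mem (mul_mem (neg_mem (pow_mem hc 3)) (sub_mem (pow_mem hH 2) hH2)) h2) hi, ?_⟩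
    rw [harmonic_succ, harmonicSq, harmonicSq, Finset.sum_range_succ]
    push_cast
    field_simp
    ring

theorem prod_one_sub_sq_cong {p : ℕ} (hp : p.Prime) {n : ℕ} (hn : n < p) :
    PCong p 3 (∏ i ∈ Finset.range n, (1 - (p : ℚ) ^ 2 / ((i : ℚ) + 1) ^ 2))
      (1 - (p : ℚ) ^ 2 * harmonicSq n) := by
  induction n with
  | zero => exact PCong.of_eq (by simp [harmonicSq])
  | succ n ih =>
    have hi := inv_succ_mem_pIntegral hp hn
    have hpm : (p : ℚ) ∈ pIntegral p := natCast_mem _ p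
    have hH2 := harmonicSq_mem_pIntegral hp (show n < p by lia)
    rw [Finset.prod_range_succ]
    have hf : 1 - (p : ℚ) ^ 2 / ((n : ℚ) + 1) ^ 2 ∈ pIntegral p := by
      rw [div_eq_mul_inv, ← inv_pow]
      exact sub_mem (one_mem _) (mul_mem (pow_mem hpm 2) (pow_mem hi 2))
    refine ((ih (by lia)).mul_right hf).trans
      ⟨p * harmonicSq n * ((n : ℚ) + 1)⁻¹ ^ 2, mul_mem (mul_mem hpm hH2) (pow_mem hi 2), ?_⟩
    rw [harmonicSq, harmonicSq, Finset.sum_range_succ]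
    field_simp
    ring

theorem PCong.of_natModEq {p a b : ℕ} (h : a ≡ b [MOD p]) : PCong p 1 a b := by
  obtain ⟨c, hc⟩ := h.symm.dvd
  refine ⟨c, intCast_mem _ c, ?_⟩
  have := congrArg (Int.cast : ℤ → ℚ) hc
  push_cast at this
  rw [this, pow_one]

theorem inv_sq_cong_pow {p : ℕ} (hp : p.Prime) (hp3 : 3 < p) {i : ℕ} (hi : i + 1 < p) :
    PCong p 1 (1 / ((i : ℚ) + 1) ^ 2) (((i : ℚ) + 1) ^ (p - 3)) := by
  have hcop : (i + 1).Coprime p :=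
    ((Nat.Prime.coprime_iff_not_dvd hp).mpr (Nat.not_dvd_of_pos_of_lt i.succ_pos hi)).symm
  have hf := PCong.of_natModEq (Nat.ModEq.pow_totient hcop)
  rw [Nat.totient_prime hp] at hf
  push_cast at hf
  have h0 : (i : ℚ) + 1 ≠ 0 := by positivity
  have h := (hf.mul_right (pow_mem (inv_succ_mem_pIntegral hp hi) 2)).symm
  rw [show p - 1 = p - 3 + 2 by lia, pow_add, mul_assoc, ← mul_pow, mul_inv_cancel₀ h0] at h
  simpa using h

/-! ### Harmonic sums modulo a prime -/

theorem prime_dvd_sum_range_pow {p : ℕ} (hp : p.Prime) {k : ℕ} (hk : k < p - 1) :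
    p ∣ ∑ i ∈ Finset.range p, i ^ k := by
  have := Fact.mk hp
  rw [← CharP.cast_eq_zero_iff (ZMod p) p]
  have h := FiniteField.sum_pow_lt_card_sub_one (K := ZMod p) k (by simpa [ZMod.card] using hk)
  rw [← h]
  push_cast
  refine Finset.sum_bij' (fun i _ => (i : ZMod p)) (fun x _ => x.val) ?_ ?_ ?_ ?_ ?_
  · simp
  · simp [ZMod.val_lt]
  · intro i hi
    exact ZMod.val_cast_of_lt (Finset.mem_range.mp hi)
  · simp
  · simp

theorem harmonicSq_sub_one_cong {p : ℕ} (hp : p.Prime) (hp3 : 3 < p) :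
    PCong p 1 (harmonicSq (p - 1)) 0 := by
  have h1 : PCong p 1 (harmonicSq (p - 1)) (∑ i ∈ Finset.range (p - 1), ((i : ℚ) + 1) ^ (p - 3)) :=
    PCong.sum fun i hi => inv_sq_cong_pow hp hp3 (by
      have := Finset.mem_range.mp hi
      lia)
  refine h1.trans ?_
  obtain ⟨c, hc⟩ := prime_dvd_sum_range_pow hp (show p - 3 < p - 1 by lia)
  refine ⟨c, natCast_mem _ c, ?_⟩
  rw [Finset.range_eq_Ico, Finset.sum_eq_sum_Ico_succ_bot hp.pos, zero_pow (by lia), zero_add,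
    Finset.sum_Ico_eq_sum_range] at hc
  have := congrArg (Nat.cast : ℕ → ℚ) hc
  push_cast at this
  rw [pow_one, sub_zero, ← this]
  exact Finset.sum_congr rfl fun i _ => by ring

theorem inv_sq_reflect_cong {p : ℕ} (hp : p.Prime) {s : ℕ} (h0 : 0 < s) (hs : s < p) :
    PCong p 1 (1 / ((p : ℚ) - s) ^ 2) (1 / (s : ℚ) ^ 2) := by
  have i1 := inv_mem_pIntegral hp h0 hs 0 (x := s) (by simp)
  have i2 := inv_mem_pIntegral hp (r := p - s) (by lia) (by lia) 0 (x := (p : ℚ) - s)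
    (by simp [Nat.cast_sub hs.le])
  have n1 := ne_zero_of_eq_add_mul hp h0 hs 0 (x := s) (by simp)
  have n2 := ne_zero_of_eq_add_mul hp (r := p - s) (by lia) (by lia) 0 (x := (p : ℚ) - s)
    (by simp [Nat.cast_sub hs.le])
  refine ⟨(2 * s - p) * ((s : ℚ)⁻¹) ^ 2 * ((p : ℚ) - s)⁻¹ ^ 2, ?_, ?_⟩
  · refine mul_mem (mul_mem (sub_mem (mul_mem ?_ (natCast_mem _ s)) (natCast_mem _ p))
      (pow_mem i1 2)) (pow_mem i2 2)
    exact_mod_cast natCast_mem (pIntegral p) 2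
  · field_simp
    ring

theorem harmonicSq_half_cong {m : ℕ} (hp : (2 * m + 1).Prime) (hp3 : 3 < 2 * m + 1) :
    PCong (2 * m + 1) 1 (harmonicSq m) 0 := by
  have h := harmonicSq_sub_one_cong hp hp3
  have h1 : PCong (2 * m + 1) 1 (harmonicSq (2 * m + 1 - 1)) (harmonicSq m * 2) := by
    rw [Nat.add_sub_cancel, two_mul m, harmonicSq, Finset.sum_range_add, ← harmonicSq, mul_two]
    refine (PCong.refl _).add ?_
    rw [← Finset.sum_range_reflect]
    refine PCong.sum fun i hi => ?_
    have hi' := Finset.mem_range.mp hi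
    have h2 := inv_sq_reflect_cong hp (s := i + 1) (by lia) (by lia)
    rw [← two_mul]
    convert h2 using 3
    · rw [Nat.cast_add, Nat.cast_sub (by lia), Nat.cast_sub (by lia)]
      push_cast
      ring
    · push_cast
      ring
  have h2 := h1.symm.trans h
  refine PCong.mul_right_cancel (inv_two_mem_pIntegral hp (by lia)) two_ne_zero ?_
  simpa using h2

theorem eulerPoly_prime_cong {p n : ℕ} : PCong p 1 (eulerPoly n p) (eulerNumber n) := by
  rw [eulerPoly, Finset.sum_range_succ]
  have h : PCong p 1 (∑ k ∈ Finset.range n, (p : ℚ) ^ (n - k) * (n.choose k : ℚ) * eulerNumber k)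
      (∑ k ∈ Finset.range n, 0) := by
    refine PCong.sum fun k hk => ?_
    have hk' := Finset.mem_range.mp hk
    obtain ⟨z, hz⟩ := eulerNumber_eq_intCast k
    refine ⟨(p : ℚ) ^ (n - k - 1) * n.choose k * z,
      mul_mem (mul_mem (pow_mem (natCast_mem _ p) _) (natCast_mem _ _)) (intCast_mem _ z), ?_⟩
    rw [hz, show n - k = n - k - 1 + 1 by lia, pow_succ]
    simp
    ring
  simpa using h.add (PCong.refl _)

theorem altHarmonicSq_half_cong {m : ℕ} (hp : (2 * m + 1).Prime) (hp3 : 3 < 2 * m + 1) :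
    PCong (2 * m + 1) 1 (altHarmonicSq m) (2 * (-1) ^ m * eulerNumber (2 * m + 1 - 3)) := by
  have hE := sum_alternating_even_pow (n := 2 * m + 1 - 3) ⟨m - 1, by lia⟩ (by lia) m
  have h2 : (2 : ℚ) ∈ pIntegral (2 * m + 1) := by
    exact_mod_cast natCast_mem (pIntegral (2 * m + 1)) 2
  have h1 : PCong (2 * m + 1) 1 (altHarmonicSq m)
      (2 * ∑ i ∈ Finset.range m, (-1 : ℚ) ^ (i + 1) *
        (2 * (2 * ((i : ℚ) + 1)) ^ (2 * m + 1 - 3))) := by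
    rw [altHarmonicSq, Finset.mul_sum]
    refine PCong.sum fun i hi => ?_
    have hi' := Finset.mem_range.mp hi
    have h3 := inv_sq_cong_pow hp hp3 (i := 2 * i + 1) (by lia)
    have h4 : (-1 : ℚ) ^ (i + 1) * 2 * 2 ∈ pIntegral (2 * m + 1) :=
      mul_mem (mul_mem (pow_mem (neg_mem (one_mem _)) _) h2) h2
    have h5 := h3.mul_left h4
    push_cast at h5
    have e : (2 * (i : ℚ) + 1 + 1) = 2 * (i + 1) := by ring
    rw [e] at h5
    convert h5 using 1
    · have : (i : ℚ) + 1 ≠ 0 := by positivity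
      field_simp
    · rw [show 2 * m + 1 - 3 = 2 * m - 2 by lia]
      ring
  refine h1.trans ?_
  rw [hE]
  have h6 := (eulerPoly_prime_cong (p := 2 * m + 1) (n := 2 * m + 1 - 3)).mul_left
    (mul_mem h2 (pow_mem (neg_mem (one_mem _)) m))
  push_cast at h6
  rw [← mul_assoc]
  exact h6

/-! ### Products modulo a prime -/

theorem cast_choose_add_eq_prod (n k : ℕ) :
    ((n + k).choose k : ℚ) = ∏ i ∈ Finset.range k, ((n : ℚ) + i + 1) / (i + 1) := by
  induction k with
  | zero => simp
  | succ k ih =>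
    have h := congrArg (Nat.cast : ℕ → ℚ) (Nat.add_one_mul_choose_eq (n + k) k)
    push_cast at h
    rw [Finset.prod_range_succ, ← ih, ← add_assoc]
    have : (k : ℚ) + 1 ≠ 0 := by positivity
    field_simp
    linear_combination -h

theorem prod_one_sub_sub_one_eq_one {p : ℕ} (hp : p.Prime) (hp2 : 2 < p) :
    ∏ i ∈ Finset.range (p - 1), (1 - (p : ℚ) / (i + 1)) = 1 := by
  have h1 : ∀ i ∈ Finset.range (p - 1),
      1 - (p : ℚ) / (i + 1) = -1 * ((p : ℚ) - (i + 1)) / ((i : ℚ) + 1) := by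
    intro i _
    have : (i : ℚ) + 1 ≠ 0 := by positivity
    field_simp
    ring
  rw [Finset.prod_congr rfl h1, Finset.prod_div_distrib, Finset.prod_mul_distrib,
    Finset.prod_const, Finset.card_range,
    (hp.even_sub_one (by lia)).neg_one_pow, one_mul, ← Finset.prod_range_reflect, div_eq_one_iff_eq]
  · refine Finset.prod_congr rfl fun i hi => ?_
    have hi' := Finset.mem_range.mp hi
    rw [Nat.cast_sub (by lia), Nat.cast_sub (by lia), Nat.cast_sub (by lia)]
    push_cast
    ring
  · exact Finset.prod_ne_zero_iff.mpr fun i _ => by positivity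

/-- Wolstenholme's theorem. -/
theorem choose_two_mul_prime_cong {p : ℕ} (hp : p.Prime) (hp3 : 3 < p) :
    PCong p 3 (((2 * p).choose p : ℚ) / 2) 1 := by
  have h1 : ((2 * p).choose p : ℚ) / 2 =
      ∏ i ∈ Finset.range (p - 1), (1 - (p : ℚ) ^ 2 / ((i : ℚ) + 1) ^ 2) := by
    have e : ((2 * p).choose p : ℚ) = 2 * ((p + (p - 1)).choose (p - 1) : ℚ) := by
      obtain ⟨n, rfl⟩ := Nat.exists_eq_succ_of_ne_zero hp.ne_zero
      rw [show 2 * n.succ = 2 * n + 1 + 1 by lia, Nat.choose_succ_succ, Nat.choose_symm_half,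
        show n.succ + (n.succ - 1) = 2 * n + 1 by lia, Nat.succ_sub_one]
      push_cast
      ring
    rw [e, mul_div_cancel_left₀ _ two_ne_zero, cast_choose_add_eq_prod,
      ← mul_one (Finset.prod (Finset.range (p - 1)) fun i => ((p : ℚ) + i + 1) / (i + 1))]
    refine (congrArg _ (prod_one_sub_sub_one_eq_one hp (by lia)).symm).trans ?_
    rw [← Finset.prod_mul_distrib]
    refine Finset.prod_congr rfl fun i _ => ?_
    have : (i : ℚ) + 1 ≠ 0 := by positivity
    field_simp
    ring
  rw [h1]
  refine (prod_one_sub_sq_cong hp (by lia)).trans ?_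
  have h2 := ((harmonicSq_sub_one_cong hp hp3).prime_pow_mul 2)
  have h3 := (PCong.refl 1).add (h2.mul_left (neg_mem (one_mem _)))
  convert h3 using 1 <;> ring

theorem prod_one_sub_half_cong {p m : ℕ} (hp : p.Prime) (hp3 : 3 < p) (hm : p = 2 * m + 1) {c : ℚ}
    (hc : c ∈ pIntegral p) :
    PCong p 3 (∏ i ∈ Finset.range m, (1 - c * p / ((i : ℚ) + 1)))
      (1 - c * (p * harmonic m) + c ^ 2 * (p * harmonic m) ^ 2 / 2) := by
  refine (prod_one_sub_cong hp (by lia) hc (by lia)).trans ?_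
  have h : PCong p 1 (harmonicSq m) 0 := by
    subst hm
    exact harmonicSq_half_cong hp hp3
  have h1 := (h.prime_pow_mul 2).mul_left
    (neg_mem (mul_mem (pow_mem hc 2) (inv_two_mem_pIntegral hp (by lia))))
  have h2 := (PCong.refl (1 - c * (p * harmonic m) + c ^ 2 * (p * harmonic m) ^ 2 / 2)).add h1
  convert h2 using 1 <;> ring

theorem four_pow_mul_prod_one_sub_half {p m : ℕ} (hm : p = 2 * m + 1) :
    4 ^ m * ∏ i ∈ Finset.range m, (1 - 2⁻¹ * (p : ℚ) / ((i : ℚ) + 1)) =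
      ∏ i ∈ Finset.range m, (1 - 1 * (p : ℚ) / ((i : ℚ) + 1)) := by
  have h1 : ∏ i ∈ Finset.range m, (2 * (2 * (i : ℚ) + 1)) =
      ∏ i ∈ Finset.range m, ((m : ℚ) + 1 + i) := by
    clear hm
    induction m with
    | zero => simp
    | succ m ih =>
      rw [Finset.prod_range_succ, ih]
      have h2 : ((m : ℚ) + 1) * ∏ i ∈ Finset.range (m + 1), (((m + 1 : ℕ) : ℚ) + 1 + i) =
          ∏ i ∈ Finset.range (m + 2), ((m : ℚ) + 1 + i) := by
        rw [Finset.prod_range_succ' _ (m + 1), mul_comm]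
        push_cast
        congr 1
        · exact Finset.prod_congr rfl fun i _ => by ring
        · ring
      rw [Finset.prod_range_succ _ (m + 1), Finset.prod_range_succ _ m] at h2
      have h0 : (m : ℚ) + 1 ≠ 0 := by positivity
      refine mul_left_cancel₀ h0 ?_
      rw [Finset.prod_range_succ _ m, h2, Finset.prod_range_succ _ m]
      push_cast
      ring
  have h3 : ∏ i ∈ Finset.range m, (4 * (1 - 2⁻¹ * (p : ℚ) / ((i : ℚ) + 1))) =
      (∏ i ∈ Finset.range m, (2 * (2 * (i : ℚ) + 1))) *
        ∏ i ∈ Finset.range m, (-1 / ((i : ℚ) + 1)) := by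
    rw [← Finset.prod_range_reflect (fun i => 2 * (2 * (i : ℚ) + 1)), ← Finset.prod_mul_distrib]
    refine Finset.prod_congr rfl fun i hi => ?_
    have hi' := Finset.mem_range.mp hi
    rw [Nat.cast_sub (by lia), Nat.cast_sub (by lia), hm]
    have : (i : ℚ) + 1 ≠ 0 := by positivity
    push_cast
    field_simp
    ring
  have h4 : ∏ i ∈ Finset.range m, (1 - 1 * (p : ℚ) / ((i : ℚ) + 1)) =
      (∏ i ∈ Finset.range m, ((m : ℚ) + 1 + i)) *
        ∏ i ∈ Finset.range m, (-1 / ((i : ℚ) + 1)) := by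
    rw [← Finset.prod_range_reflect (fun i => (m : ℚ) + 1 + i), ← Finset.prod_mul_distrib]
    refine Finset.prod_congr rfl fun i hi => ?_
    have hi' := Finset.mem_range.mp hi
    rw [Nat.cast_sub (by lia), Nat.cast_sub (by lia), hm]
    have : (i : ℚ) + 1 ≠ 0 := by positivity
    push_cast
    field_simp
    ring
  rw [h4, ← h1, ← h3, Finset.prod_mul_distrib]
  simp

theorem ofNat_mem_pIntegral {p : ℕ} (n : ℕ) [n.AtLeastTwo] :
    (OfNat.ofNat n : ℚ) ∈ pIntegral p := by
  exact_mod_cast natCast_mem (pIntegral p) n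

theorem four_pow_half_cong {p m : ℕ} (hp : p.Prime) (hp3 : 3 < p) (hm : p = 2 * m + 1) :
    PCong p 3 (4 ^ m) (1 - p * harmonic m / 2 + (p * harmonic m) ^ 2 / 8) := by
  have h2 := inv_two_mem_pIntegral hp (by lia)
  have hH := harmonic_mem_pIntegral hp (show m < p by lia)
  have hpm : (p : ℚ) ∈ pIntegral p := natCast_mem _ p
  have h4 : (4 ^ m : ℚ) ∈ pIntegral p := pow_mem (ofNat_mem_pIntegral 4) m
  have hx : (p : ℚ) * harmonic m * 2⁻¹ ∈ pIntegral p := mul_mem (mul_mem hpm hH) h2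
  have ha := (prod_one_sub_half_cong hp hp3 hm h2).mul_left h4
  rw [four_pow_mul_prod_one_sub_half hm] at ha
  have hb := ha.symm.trans (prod_one_sub_half_cong hp hp3 hm (one_mem _))
  have hc := hb.mul_right (c := 1 + (p : ℚ) * harmonic m * 2⁻¹ +
    ((p : ℚ) * harmonic m * 2⁻¹) ^ 2 * 2⁻¹)
    (add_mem (add_mem (one_mem _) hx) (mul_mem (pow_mem hx 2) h2))
  have hl : PCong p 3 (4 ^ m)
      (4 ^ m * (1 - 2⁻¹ * (p * harmonic m) + 2⁻¹ ^ 2 * (p * harmonic m) ^ 2 / 2) *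
        (1 + p * harmonic m * 2⁻¹ + (p * harmonic m * 2⁻¹) ^ 2 * 2⁻¹)) :=
    ⟨-(4 ^ m * p * (harmonic m * 2⁻¹) ^ 4 * 2⁻¹ ^ 2),
      neg_mem (mul_mem (mul_mem (mul_mem h4 hpm) (pow_mem (mul_mem hH h2) 4)) (pow_mem h2 2)),
      by ring⟩
  refine (hl.trans hc).trans
    ⟨(harmonic m * 2⁻¹) ^ 3 + p * (harmonic m * 2⁻¹) ^ 4,
      add_mem (pow_mem (mul_mem hH h2) 3) (mul_mem hpm (pow_mem (mul_mem hH h2) 4)), by ring⟩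

theorem hyperTerm_half {p m : ℕ} (hm : p = 2 * m + 1) :
    hyperTerm p m = (-1) ^ m * ((∏ i ∈ Finset.range m, (1 - 1 * (p : ℚ) / ((i : ℚ) + 1))) ^ 2 *
      ∏ i ∈ Finset.range m, (1 - -2⁻¹ * (p : ℚ) / ((i : ℚ) + 1))) := by
  have h1 : ∏ i ∈ Finset.range m, ((p : ℚ) + 2 * i + 1) =
      ∏ i ∈ Finset.range m, (2 * ((p : ℚ) - (i + 1))) := by
    rw [← Finset.prod_range_reflect]
    refine Finset.prod_congr rfl fun i hi => ?_
    have hi' := Finset.mem_range.mp hi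
    rw [Nat.cast_sub (by lia), Nat.cast_sub (by lia), hm]
    push_cast
    ring
  have h2 : hyperTerm p m = (∏ i ∈ Finset.range m, ((p : ℚ) + 2 * i + 1)) *
      ∏ i ∈ Finset.range m, ((p + 2 * i + 2) * (i + 1 - p) / (4 * ((i : ℚ) + 1) ^ 3)) := by
    rw [hyperTerm, ← Finset.prod_mul_distrib]
    exact Finset.prod_congr rfl fun i _ => by ring
  have h3 : (-1 : ℚ) ^ m = ∏ _i ∈ Finset.range m, (-1 : ℚ) := by simp
  rw [h2, h1, h3, sq]
  simp only [← Finset.prod_mul_distrib]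
  refine Finset.prod_congr rfl fun i hi => ?_
  have : (i : ℚ) + 1 ≠ 0 := by positivity
  field_simp
  ring

theorem hyperTerm_half_cong {p m : ℕ} (hp : p.Prime) (hp3 : 3 < p) (hm : p = 2 * m + 1) :
    PCong p 3 (hyperTerm p m)
      ((-1) ^ m * (1 - 3 / 2 * (p * harmonic m) + 9 / 8 * (p * harmonic m) ^ 2)) := by
  have h2 := inv_two_mem_pIntegral hp (by lia)
  have hH := harmonic_mem_pIntegral hp (show m < p by lia)
  have hpm : (p : ℚ) ∈ pIntegral p := natCast_mem _ p
  have hs : (-1 : ℚ) ^ m ∈ pIntegral p := pow_mem (neg_mem (one_mem _)) m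
  have hy := mul_mem hpm hH
  have mem : ∀ c ∈ pIntegral p, 1 - c * (p * harmonic m) + c ^ 2 * (p * harmonic m) ^ 2 / 2 ∈
      pIntegral p := fun c hc => by
    rw [div_eq_mul_inv]
    exact add_mem (sub_mem (one_mem _) (mul_mem hc hy))
      (mul_mem (mul_mem (pow_mem hc 2) (pow_mem hy 2)) h2)
  have h1 := prod_one_sub_half_cong hp hp3 hm (one_mem _)
  have h3 := prod_one_sub_half_cong hp hp3 hm (neg_mem h2)
  have m1 := mem _ (one_mem _)
  have m3 := mem _ (neg_mem h2)
  rw [hyperTerm_half hm, sq]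
  refine ((((h1.mul h1 m1 (h1.mem_pIntegral m1)).mul h3 (mul_mem m1 m1)
    (h3.mem_pIntegral m3))).mul_left hs).trans ?_
  refine ⟨(-1) ^ m * (-(harmonic m ^ 3 * 2⁻¹ ^ 2) + p ^ 3 * harmonic m ^ 6 * 2⁻¹ ^ 5),
    mul_mem hs (add_mem (neg_mem (mul_mem (pow_mem hH 3) (pow_mem h2 2)))
      (mul_mem (mul_mem (pow_mem hpm 3) (pow_mem hH 6)) (pow_mem h2 5))), by ring⟩

/-! ### The hypergeometric terms around the middle index -/

theorem hyperTerm_succ (x : ℚ) (j : ℕ) :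
    hyperTerm x (j + 1) = hyperTerm x j *
      ((x + 2 * j + 1) * (x + 2 * j + 2) * (j + 1 - x) / (4 * ((j : ℚ) + 1) ^ 3)) := by
  rw [hyperTerm, Finset.prod_range_succ, ← hyperTerm]

/-- The inverse ratio of consecutive hypergeometric terms below the middle index. -/
theorem inv_ratio_cong {p m s : ℕ} (hp : p.Prime) (hm : p = 2 * m + 1) (h0 : 0 < s) (hs : s ≤ m)
    {t : ℚ} (ht : t = 2 * s - 1 - p) :
    PCong p 2 (t ^ 3 / ((2 * s - 2 * p) * (t - p) * (t + 2 * p)))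
      (t / 2 * (s : ℚ)⁻¹ * (1 + p * ((s : ℚ)⁻¹ - t⁻¹))) := by
  have d : ((2 * s - 1 : ℕ) : ℚ) = 2 * s - 1 := by
    rw [Nat.cast_sub (by lia)]
    push_cast
    ring
  have e2 : ((2 * s : ℕ) : ℚ) = 2 * s := by push_cast; ring
  have i1 := inv_mem_pIntegral hp (r := 2 * s) (by lia) (by lia) (-2) (x := 2 * (s : ℚ) - 2 * p)
    (by rw [e2]; push_cast; ring)
  have i2 := inv_mem_pIntegral hp (r := 2 * s - 1) (by lia) (by lia) (-2) (x := t - p)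
    (by rw [d, ht]; push_cast; ring)
  have i3 := inv_mem_pIntegral hp (r := 2 * s - 1) (by lia) (by lia) 1 (x := t + 2 * p)
    (by rw [d, ht]; push_cast; ring)
  have i4 := inv_mem_pIntegral hp (r := s) (by lia) (by lia) 0 (x := s) (by simp)
  have n1 := ne_zero_of_eq_add_mul hp (r := 2 * s) (by lia) (by lia) (-2)
    (x := 2 * (s : ℚ) - 2 * p) (by rw [e2]; push_cast; ring)
  have n2 := ne_zero_of_eq_add_mul hp (r := 2 * s - 1) (by lia) (by lia) (-2) (x := t - p)
    (by rw [d, ht]; push_cast; ring)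
  have n3 := ne_zero_of_eq_add_mul hp (r := 2 * s - 1) (by lia) (by lia) 1 (x := t + 2 * p)
    (by rw [d, ht]; push_cast; ring)
  have n4 := ne_zero_of_eq_add_mul hp (r := s) (by lia) (by lia) 0 (x := s) (by simp)
  have n5 := ne_zero_of_eq_add_mul hp (r := 2 * s - 1) (by lia) (by lia) (-1) (x := t)
    (by rw [d, ht]; push_cast; ring)
  have hs : (s : ℚ) ∈ pIntegral p := natCast_mem _ s
  have hpm : (p : ℚ) ∈ pIntegral p := natCast_mem _ p
  have htm : t ∈ pIntegral p := by
    rw [ht]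
    exact sub_mem (sub_mem (mul_mem (ofNat_mem_pIntegral 2) hs) (one_mem _)) hpm
  refine ⟨-(-3 * t * s ^ 2 + 2 * p * s ^ 2 - (t - s) * (t ^ 2 + p * t - 2 * p ^ 2)) *
    ((s : ℚ)⁻¹ ^ 2 * (2 * (s : ℚ) - 2 * p)⁻¹ * (t - p)⁻¹ * (t + 2 * p)⁻¹), ?_, ?_⟩
  · have h2 := ofNat_mem_pIntegral (p := p) 2
    have h3 := ofNat_mem_pIntegral (p := p) 3
    exact mul_mem (neg_mem (sub_mem (add_mem (mul_mem (mul_mem (neg_mem h3) htm) (pow_mem hs 2))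
      (mul_mem (mul_mem h2 hpm) (pow_mem hs 2))) (mul_mem (sub_mem htm hs) (sub_mem (add_mem
      (pow_mem htm 2) (mul_mem hpm htm)) (mul_mem h2 (pow_mem hpm 2))))))
      (mul_mem (mul_mem (mul_mem (pow_mem i4 2) i1) i2) i3)
  · have n1' : (s : ℚ) - p ≠ 0 := fun h => n1 (by linear_combination 2 * h)
    rw [show (2 * (s : ℚ) - 2 * p) = 2 * (s - p) by ring]
    clear ht d e2
    field_simp
    ring

theorem hyperTerm_half_mem_pIntegral {p m : ℕ} (hp : p.Prime) (hp3 : 3 < p)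
    (hm : p = 2 * m + 1) : hyperTerm p m ∈ pIntegral p := by
  refine (hyperTerm_half_cong hp hp3 hm).mem_pIntegral ?_
  have h2 := inv_two_mem_pIntegral hp (by lia)
  have hy := mul_mem (natCast_mem (pIntegral p) p) (harmonic_mem_pIntegral hp (show m < p by lia))
  have e : (-1) ^ m * (1 - 3 / 2 * ((p : ℚ) * harmonic m) + 9 / 8 * (p * harmonic m) ^ 2) =
      (-1) ^ m * (1 - 3 * 2⁻¹ * (p * harmonic m) + 9 * 2⁻¹ ^ 3 * (p * harmonic m) ^ 2) := by ring
  rw [e]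
  exact mul_mem (pow_mem (neg_mem (one_mem _)) m) (add_mem (sub_mem (one_mem _)
    (mul_mem (mul_mem (ofNat_mem_pIntegral 3) h2) hy))
    (mul_mem (mul_mem (ofNat_mem_pIntegral 9) (pow_mem h2 3)) (pow_mem hy 2)))

theorem hyperTerm_half_cong_one {p m : ℕ} (hp : p.Prime) (hp3 : 3 < p) (hm : p = 2 * m + 1) :
    PCong p 1 (hyperTerm p m) ((-1) ^ m) := by
  have h2 := inv_two_mem_pIntegral hp (by lia)
  have hpm : (p : ℚ) ∈ pIntegral p := natCast_mem _ p
  have hH := harmonic_mem_pIntegral hp (show m < p by lia)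
  refine ((hyperTerm_half_cong hp hp3 hm).of_le (by lia)).trans
    ⟨(-1) ^ m * (-(3 * 2⁻¹ * harmonic m) + 9 * 2⁻¹ ^ 3 * p * harmonic m ^ 2),
      mul_mem (pow_mem (neg_mem (one_mem _)) m) (add_mem (neg_mem
        (mul_mem (mul_mem (ofNat_mem_pIntegral 3) h2) hH)) (mul_mem (mul_mem
        (mul_mem (ofNat_mem_pIntegral 9) (pow_mem h2 3)) hpm) (pow_mem hH 2))), by ring⟩

/-- The hypergeometric terms below the middle index, modulo `p ^ 2`. -/
theorem hyperTerm_half_sub_cong {p m : ℕ} (hp : p.Prime) (hp3 : 3 < p) (hm : p = 2 * m + 1)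
    {r : ℕ} (hr : r ≤ m) :
    PCong p 2 (hyperTerm p (m - r)) (hyperTerm p m * ((-1) ^ r * (m.choose r : ℚ) *
      (1 + p * (harmonic r + 2⁻¹ * (harmonic m - harmonic (m - r)))))) := by
  have h2 := inv_two_mem_pIntegral hp (by lia)
  have hpm : (p : ℚ) ∈ pIntegral p := natCast_mem _ p
  have hs : ∀ r, (-1 : ℚ) ^ r ∈ pIntegral p := fun r => pow_mem (neg_mem (one_mem _)) r
  have hH : ∀ n ≤ m, harmonic n ∈ pIntegral p := fun n hn =>
    harmonic_mem_pIntegral hp (show n < p by lia)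
  have he := hyperTerm_half_mem_pIntegral hp hp3 hm
  induction r with
  | zero => exact PCong.of_eq (by simp)
  | succ r ih =>
    obtain ⟨j, hj⟩ : ∃ j, m = r + 1 + j := Nat.exists_eq_add_of_le hr
    have e1 : m - r = j + 1 := by lia
    have e2 : m - (r + 1) = j := by lia
    have hmq : (m : ℚ) = r + 1 + j := by rw [hj]; push_cast; ring
    have hpq : (p : ℚ) = 2 * (r + 1 + j) + 1 := by rw [hm, ← hmq]; push_cast; ring
    obtain ⟨t, ht⟩ : ∃ t : ℚ, t = 2 * (r + 1 : ℕ) - 1 - p := ⟨_, rfl⟩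
    have htj : t = -2 * (j + 1) := by rw [ht, hpq]; push_cast; ring
    have hρ := inv_ratio_cong hp hm (Nat.succ_pos r) hr ht
    have iH := ih (by lia)
    rw [e1] at iH
    have js := inv_succ_mem_pIntegral hp (i := r) (by lia)
    have jt : t⁻¹ ∈ pIntegral p := by
      rw [htj, mul_inv, inv_neg]
      exact mul_mem (neg_mem h2) (inv_succ_mem_pIntegral hp (i := j) (by lia))
    have hfac : hyperTerm p j = hyperTerm p (j + 1) *
        (t ^ 3 / ((2 * (r + 1 : ℕ) - 2 * p) * (t - p) * (t + 2 * p))) := by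
      have hD : (2 * ((r + 1 : ℕ) : ℚ) - 2 * p) * (t - p) * (t + 2 * p) =
          -2 * (p + 2 * j + 1) * (p + 2 * j + 2) * (j + 1 - p) := by
        rw [htj, hpq]
        push_cast
        ring
      have n1 : (p : ℚ) + 2 * j + 1 ≠ 0 := by positivity
      have n2 : (p : ℚ) + 2 * j + 2 ≠ 0 := by positivity
      have n3 : (j : ℚ) + 1 - p ≠ 0 := by
        have : (0 : ℚ) < 2 * r + j + 2 := by positivity
        rw [hpq]
        intro h
        linarith
      have n4 : (j : ℚ) + 1 ≠ 0 := by positivity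
      rw [hyperTerm_succ, hD, htj]
      field_simp
      ring
    have hx : harmonic r + 2⁻¹ * (harmonic m - harmonic (j + 1)) ∈ pIntegral p :=
      add_mem (hH r (by lia)) (mul_mem h2 (sub_mem (hH m le_rfl) (hH (j + 1) (by lia))))
    have hC : (m.choose r : ℚ) ∈ pIntegral p := natCast_mem _ _
    have hδ := sub_mem js jt
    have htm : t ∈ pIntegral p := by
      rw [htj]
      exact mul_mem (neg_mem (ofNat_mem_pIntegral 2)) (add_mem (natCast_mem _ j) (one_mem _))
    have hρm : t / 2 * ((r + 1 : ℕ) : ℚ)⁻¹ * (1 + p * (((r + 1 : ℕ) : ℚ)⁻¹ - t⁻¹)) ∈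
        pIntegral p := by
      push_cast
      rw [div_eq_mul_inv]
      exact mul_mem (mul_mem (mul_mem htm h2) js) (add_mem (one_mem _) (mul_mem hpm hδ))
    have hy := mul_mem he (mul_mem (mul_mem (hs r) hC)
      (add_mem (one_mem _) (mul_mem hpm hx)))
    rw [e2, hfac]
    refine (iH.mul hρ hy (hρ.mem_pIntegral hρm)).trans ?_
    refine ⟨hyperTerm p m * ((-1) ^ r * m.choose r *
      (harmonic r + 2⁻¹ * (harmonic m - harmonic (j + 1))) *
      (t * 2⁻¹ * ((r : ℚ) + 1)⁻¹) * (((r : ℚ) + 1)⁻¹ - t⁻¹)),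
      mul_mem he (mul_mem (mul_mem (mul_mem (mul_mem (hs r) hC) hx)
        (mul_mem (mul_mem htm h2) js)) hδ), ?_⟩
    have hc : (m.choose (r + 1) : ℚ) = -(m.choose r * (t / 2) * ((r : ℚ) + 1)⁻¹) := by
      have h := cast_choose_succ_mul m r
      have n0 : (r : ℚ) + 1 ≠ 0 := by positivity
      rw [htj]
      field_simp
      rw [h, hmq]
      ring
    have hj1 : harmonic (j + 1) = harmonic j - 2 * t⁻¹ := by
      rw [harmonic_succ, htj]
      have n0 : (j : ℚ) + 1 ≠ 0 := by positivity
      push_cast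
      field_simp
      ring
    rw [hc, hj1, harmonic_succ, pow_succ]
    push_cast
    ring

/-- The ratio of consecutive hypergeometric terms above the middle index. -/
theorem ratio_cong {p s : ℕ} (hp : p.Prime) (hs : 2 * s + 1 < p) :
    PCong p 1 ((2 * p + 2 * s) * (2 * p + 2 * s + 1) * (2 * s + 1 - p) / (p + 1 + 2 * s) ^ 3)
      (2 * s / (2 * s + 1 - p)) ∧ (2 * s / (2 * s + 1 - p) : ℚ) ∈ pIntegral p := by
  have hpm : (p : ℚ) ∈ pIntegral p := natCast_mem _ p
  have hsm : (s : ℚ) ∈ pIntegral p := natCast_mem _ s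
  have h2 := ofNat_mem_pIntegral (p := p) 2
  have i1 := inv_mem_pIntegral hp (r := 2 * s + 1) (by lia) hs 1 (x := (p : ℚ) + 1 + 2 * s)
    (by push_cast; ring)
  have i2 := inv_mem_pIntegral hp (r := 2 * s + 1) (by lia) hs (-1) (x := 2 * (s : ℚ) + 1 - p)
    (by push_cast; ring)
  have n1 := ne_zero_of_eq_add_mul hp (r := 2 * s + 1) (by lia) hs 1 (x := (p : ℚ) + 1 + 2 * s)
    (by push_cast; ring)
  have n2 := ne_zero_of_eq_add_mul hp (r := 2 * s + 1) (by lia) hs (-1)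
    (x := 2 * (s : ℚ) + 1 - p) (by push_cast; ring)
  refine ⟨?_, by rw [div_eq_mul_inv]; exact mul_mem (mul_mem h2 hsm) i2⟩
  obtain ⟨u, hu⟩ : ∃ u : ℚ, u = 2 * s + 1 := ⟨_, rfl⟩
  have hum : u ∈ pIntegral p := by
    rw [hu]
    exact add_mem (mul_mem h2 hsm) (one_mem _)
  have e1 : (p : ℚ) + 1 + 2 * s = p + u := by rw [hu]; ring
  have e2 : 2 * (p : ℚ) + 2 * s + 1 = 2 * p + u := by rw [hu]; ring
  have e3 : (2 * (s : ℚ)) = u - 1 := by rw [hu]; ring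
  rw [e1] at i1 n1
  rw [← hu] at i2 n2
  rw [e1, e2, ← hu, e3]
  refine ⟨(u ^ 2 * (3 - u) + 6 * (u - u ^ 2) * p - (5 * u + 1) * p ^ 2 + 4 * p ^ 3) *
    ((p + u)⁻¹ ^ 3 * (u - p)⁻¹), ?_, ?_⟩
  · exact mul_mem (add_mem (sub_mem (add_mem (mul_mem (pow_mem hum 2)
      (sub_mem (ofNat_mem_pIntegral 3) hum)) (mul_mem (mul_mem (ofNat_mem_pIntegral 6)
      (sub_mem hum (pow_mem hum 2))) hpm)) (mul_mem (add_mem (mul_mem (ofNat_mem_pIntegral 5) hum)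
      (one_mem _)) (pow_mem hpm 2))) (mul_mem (ofNat_mem_pIntegral 4) (pow_mem hpm 3)))
      (mul_mem (pow_mem i1 3) i2)
  · field_simp
    ring

/-- The hypergeometric terms above the middle index, which are divisible by `p`, modulo `p ^ 2`. -/
theorem hyperTerm_half_add_cong {p m : ℕ} (hp : p.Prime) (hp3 : 3 < p) (hm : p = 2 * m + 1)
    {r : ℕ} (hr : r < m) :
    PCong p 1 (hyperTerm p (m + (r + 1)) / p)
        ((-1) ^ m * ((-1) ^ (r + 1) / ((r + 1) * (m.choose (r + 1) : ℚ)))) ∧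
      (-1) ^ m * ((-1) ^ (r + 1) / ((r + 1) * (m.choose (r + 1) : ℚ))) ∈ pIntegral p := by
  have hpm : (p : ℚ) ∈ pIntegral p := natCast_mem _ p
  have hp0 : (p : ℚ) ≠ 0 := by exact_mod_cast hp.ne_zero
  have hpq : (p : ℚ) = 2 * m + 1 := by rw [hm]; push_cast; ring
  have hs : (-1 : ℚ) ^ m ∈ pIntegral p := pow_mem (neg_mem (one_mem _)) m
  induction r with
  | zero =>
    have i1 := inv_mem_pIntegral hp (r := 1) (by lia) (by lia) 1 (x := (p : ℚ) + 1)
      (by push_cast; ring)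
    have im := inv_mem_pIntegral hp (r := m) (by lia) (by lia) 0 (x := (m : ℚ)) (by simp)
    have m0 : (m : ℚ) ≠ 0 := by
      have : m ≠ 0 := by lia
      exact_mod_cast this
    have e1 : hyperTerm p (m + (0 + 1)) / p =
        hyperTerm p m * (2 * (2 * p + 1) * (1 - p) / (p + 1) ^ 3) := by
      rw [zero_add, hyperTerm_succ]
      have n1 : (m : ℚ) + 1 ≠ 0 := by positivity
      have n2 : (p : ℚ) + 1 ≠ 0 := by positivity
      have e : (p : ℚ) + 1 = 2 * (m + 1) := by rw [hpq]; ring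
      rw [e, hpq] at *
      field_simp
      ring
    have e2 : (-1 : ℚ) ^ m * ((-1) ^ (0 + 1) / (((0 : ℕ) + 1) * (m.choose (0 + 1) : ℚ))) =
        (-1) ^ m * -(m : ℚ)⁻¹ := by
      simp
      ring
    have h3 : PCong p 1 (2 * (2 * (p : ℚ) + 1) * (1 - p) / (p + 1) ^ 3) (-(m : ℚ)⁻¹) := by
      have n1 : (p : ℚ) + 1 ≠ 0 := by positivity
      refine ⟨(3 + 6 * p - p ^ 2) * (m : ℚ)⁻¹ * ((p : ℚ) + 1)⁻¹ ^ 3, ?_, ?_⟩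
      · exact mul_mem (mul_mem (sub_mem (add_mem (ofNat_mem_pIntegral 3)
          (mul_mem (ofNat_mem_pIntegral 6) hpm)) (pow_mem hpm 2)) im) (pow_mem i1 3)
      · rw [hpq] at *
        field_simp
        ring
    rw [e1, e2]
    refine ⟨(hyperTerm_half_cong_one hp hp3 hm).mul h3 hs (h3.mem_pIntegral (neg_mem im)),
      mul_mem hs (neg_mem im)⟩
  | succ r ih =>
    obtain ⟨h1, h1m⟩ := ih (by lia)
    obtain ⟨hg, hgm⟩ := ratio_cong hp (s := r + 1) (by lia)
    have e1 : hyperTerm p (m + (r + 1 + 1)) / p = hyperTerm p (m + (r + 1)) / p *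
        ((2 * p + 2 * (r + 1 : ℕ)) * (2 * p + 2 * (r + 1 : ℕ) + 1) * (2 * (r + 1 : ℕ) + 1 - p) /
          (p + 1 + 2 * (r + 1 : ℕ)) ^ 3) := by
      rw [← add_assoc m, hyperTerm_succ]
      have n1 : (m : ℚ) + (r + 1) + 1 ≠ 0 := by positivity
      have e : (p : ℚ) + 1 + 2 * (r + 1) = 2 * (m + (r + 1) + 1) := by rw [hpq]; ring
      push_cast
      rw [e, hpq] at *
      field_simp
      ring
    have e2 : (-1 : ℚ) ^ m * ((-1) ^ (r + 1 + 1) /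
          (((r + 1 : ℕ) + 1) * (m.choose (r + 1 + 1) : ℚ))) =
        (-1) ^ m * ((-1) ^ (r + 1) / ((r + 1) * (m.choose (r + 1) : ℚ))) *
          (2 * (r + 1 : ℕ) / (2 * (r + 1 : ℕ) + 1 - p)) := by
      have h := cast_choose_succ_mul m (r + 1)
      have c0 : (m.choose (r + 1) : ℚ) ≠ 0 := by
        exact_mod_cast (Nat.choose_pos (show r + 1 ≤ m by lia)).ne'
      have n0 : (r : ℚ) + 1 ≠ 0 := by positivity
      have n1 : (m : ℚ) - (r + 1) ≠ 0 := by
        have : m ≠ r + 1 := by lia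
        rw [sub_ne_zero]
        exact_mod_cast this
      rw [mul_comm ((r + 1 : ℕ) + 1 : ℚ), h, hpq]
      push_cast
      rw [show 2 * ((r : ℚ) + 1) + 1 - (2 * m + 1) = -(2 * (m - (r + 1))) by ring, pow_succ]
      field_simp
    rw [e1, e2]
    exact ⟨h1.mul hg h1m (hg.mem_pIntegral hgm), mul_mem h1m hgm⟩

theorem sum_hyperTerm_half_add_cong {p m : ℕ} (hp : p.Prime) (hp3 : 3 < p) (hm : p = 2 * m + 1) :
    PCong p 2 (∑ r ∈ Finset.range m, hyperTerm p (m + (r + 1)) / (p + 2 * (r + 1)))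
      (p * ((-1) ^ m * 2⁻¹ * (harmonicSq m + 2 * altHarmonicSq m))) := by
  have hp0 : (p : ℚ) ≠ 0 := by exact_mod_cast hp.ne_zero
  have e : ∑ r ∈ Finset.range m, hyperTerm p (m + (r + 1)) / (p + 2 * (r + 1)) =
      p * ∑ r ∈ Finset.range m,
        hyperTerm p (m + (r + 1)) / p * ((p : ℚ) + 2 * (r + 1))⁻¹ := by
    rw [Finset.mul_sum]
    refine Finset.sum_congr rfl fun r _ => ?_
    field_simp
  suffices h : PCong p 1
      (∑ r ∈ Finset.range m, hyperTerm p (m + (r + 1)) / p * ((p : ℚ) + 2 * (r + 1))⁻¹)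
      ((-1) ^ m * 2⁻¹ * (harmonicSq m + 2 * altHarmonicSq m)) by
    rw [e]
    simpa only [pow_one] using h.prime_pow_mul 1
  rw [← sum_alternating_inv_sq_mul_choose, Finset.mul_sum]
  refine PCong.sum fun r hr => ?_
  have hr' := Finset.mem_range.mp hr
  obtain ⟨h, hmem⟩ := hyperTerm_half_add_cong hp hp3 hm hr'
  have e2 : ((2 * (r + 1) : ℕ) : ℚ) = 2 * (r + 1) := by push_cast; ring
  have i1 := inv_mem_pIntegral hp (r := 2 * (r + 1)) (by lia) (by lia) 1
    (x := (p : ℚ) + 2 * (r + 1)) (by rw [e2]; push_cast; ring)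
  have i2 := inv_mem_pIntegral hp (r := 2 * (r + 1)) (by lia) (by lia) 0
    (x := (2 * ((r : ℚ) + 1))) (by rw [e2]; push_cast; ring)
  have n0 : (r : ℚ) + 1 ≠ 0 := by positivity
  have h3 : PCong p 1 ((p : ℚ) + 2 * (r + 1))⁻¹ (2 * ((r : ℚ) + 1))⁻¹ := by
    refine ⟨-((p : ℚ) + 2 * (r + 1))⁻¹ * (2 * ((r : ℚ) + 1))⁻¹, mul_mem (neg_mem i1) i2, ?_⟩
    have : (p : ℚ) + 2 * (r + 1) ≠ 0 := by positivity
    field_simp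
    ring
  refine (h.mul h3 hmem i1).trans (PCong.of_eq ?_)
  have c0 : (m.choose (r + 1) : ℚ) ≠ 0 := by
    exact_mod_cast (Nat.choose_pos (show r + 1 ≤ m by lia)).ne'
  field_simp

theorem sum_hyperTerm_half_sub_cong {p m : ℕ} (hp : p.Prime) (hp3 : 3 < p) (hm : p = 2 * m + 1) :
    PCong p 2 (∑ r ∈ Finset.range m, hyperTerm p (m - (r + 1)) / (p - 2 * (r + 1)))
      (hyperTerm p m * (2⁻¹ * harmonic m + p * (2⁻¹ ^ 3 * harmonic m ^ 2 -
        2⁻¹ ^ 2 * (harmonicSq m + 2 * altHarmonicSq m)))) := by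
  have h2 := inv_two_mem_pIntegral hp (by lia)
  have hpm : (p : ℚ) ∈ pIntegral p := natCast_mem _ p
  have he := hyperTerm_half_mem_pIntegral hp hp3 hm
  have hH : ∀ n ≤ m, harmonic n ∈ pIntegral p := fun n hn =>
    harmonic_mem_pIntegral hp (show n < p by lia)
  let U : ℕ → ℚ := fun r => (-1 : ℚ) ^ (r + 1) * (m.choose (r + 1) : ℚ) / (r + 1)
  have h1 : PCong p 2 (∑ r ∈ Finset.range m, hyperTerm p (m - (r + 1)) / (p - 2 * (r + 1)))
      (∑ r ∈ Finset.range m, hyperTerm p m * (-2⁻¹) * (U r + p * (U r * harmonic (r + 1)) +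
        p * 2⁻¹ * (U r * (harmonic m - harmonic (m - (r + 1)))) +
        p * 2⁻¹ * (U r * (1 / (r + 1))))) := by
    refine PCong.sum fun r hr => ?_
    have hr' := Finset.mem_range.mp hr
    have h := hyperTerm_half_sub_cong hp hp3 hm (r := r + 1) hr'
    have e2 : ((2 * (r + 1) : ℕ) : ℚ) = 2 * (r + 1) := by push_cast; ring
    have i0 := inv_mem_pIntegral hp (r := r + 1) (by lia) (by lia) 0 (x := (r : ℚ) + 1) (by simp)
    have n0 : (r : ℚ) + 1 ≠ 0 := by positivity
    have e3 : ((p - 2 * (r + 1) : ℕ) : ℚ) = p - 2 * (r + 1) := by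
      rw [Nat.cast_sub (by lia)]
      push_cast
      ring
    have i1 := inv_mem_pIntegral hp (r := p - 2 * (r + 1)) (by lia) (by lia) 0
      (x := (p : ℚ) - 2 * (r + 1)) (by rw [e3]; simp)
    have n1 := ne_zero_of_eq_add_mul hp (r := p - 2 * (r + 1)) (by lia) (by lia) 0
      (x := (p : ℚ) - 2 * (r + 1)) (by rw [e3]; simp)
    have h3 : PCong p 2 ((p : ℚ) - 2 * (r + 1))⁻¹
        (-2⁻¹ * ((r : ℚ) + 1)⁻¹ * (1 + p * 2⁻¹ * ((r : ℚ) + 1)⁻¹)) := by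
      refine ⟨2⁻¹ ^ 2 * ((r : ℚ) + 1)⁻¹ ^ 2 * ((p : ℚ) - 2 * (r + 1))⁻¹,
        mul_mem (mul_mem (pow_mem h2 2) (pow_mem i0 2)) i1, ?_⟩
      field_simp
      ring
    have hx : harmonic (r + 1) + 2⁻¹ * (harmonic m - harmonic (m - (r + 1))) ∈ pIntegral p :=
      add_mem (hH _ hr') (mul_mem h2 (sub_mem (hH m le_rfl) (hH _ (by lia))))
    have hC : (-1 : ℚ) ^ (r + 1) * (m.choose (r + 1) : ℚ) ∈ pIntegral p :=
      mul_mem (pow_mem (neg_mem (one_mem _)) _) (natCast_mem _ _)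
    rw [div_eq_mul_inv]
    refine (h.mul h3 (mul_mem he (mul_mem hC (add_mem (one_mem _) (mul_mem hpm hx)))) i1).trans ?_
    refine ⟨hyperTerm p m * ((-1) ^ (r + 1) * m.choose (r + 1) * ((harmonic (r + 1) +
      2⁻¹ * (harmonic m - harmonic (m - (r + 1)))) * (-2⁻¹ * ((r : ℚ) + 1)⁻¹ *
      (2⁻¹ * ((r : ℚ) + 1)⁻¹)))), mul_mem he (mul_mem hC (mul_mem hx (mul_mem
        (mul_mem (neg_mem h2) i0) (mul_mem h2 i0)))), ?_⟩
    simp only [U]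
    ring
  refine h1.trans ?_
  rw [← Finset.mul_sum]
  simp only [Finset.sum_add_distrib, ← Finset.mul_sum]
  simp only [U]
  rw [sum_alternating_choose_div, sum_alternating_choose_div_mul_harmonic,
    sum_alternating_choose_div_mul_harmonic_sub, sum_alternating_choose_div_sq]
  have hS : PCong p 1 (harmonicSq m) 0 := by
    subst hm
    exact harmonicSq_half_cong hp hp3
  have h4 := (PCong.refl (hyperTerm p m * (2⁻¹ * harmonic m + p * (2⁻¹ ^ 3 * harmonic m ^ 2 -
    2⁻¹ ^ 2 * (harmonicSq m + 2 * altHarmonicSq m))))).add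
    ((hS.prime_pow_mul 1).mul_left (mul_mem he (mul_mem (ofNat_mem_pIntegral 5) (pow_mem h2 3))))
  convert h4 using 1 <;> ring

theorem sum_hyperTerm_div_split {p m : ℕ} (hm : p = 2 * m + 1) :
    ∑ j ∈ Finset.range p, hyperTerm p j / (2 * (j : ℚ) + 1) =
      ∑ r ∈ Finset.range m, hyperTerm p (m - (r + 1)) / ((p : ℚ) - 2 * (r + 1)) +
      hyperTerm p m / p +
      ∑ r ∈ Finset.range m, hyperTerm p (m + (r + 1)) / ((p : ℚ) + 2 * (r + 1)) := by
  have hpq : (p : ℚ) = 2 * m + 1 := by rw [hm]; push_cast; ring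
  have h1 : ∑ j ∈ Finset.range p, hyperTerm p j / (2 * (j : ℚ) + 1) =
      ∑ j ∈ Finset.range (m + (m + 1)), hyperTerm p j / (2 * (j : ℚ) + 1) := by
    congr 2
    lia
  rw [h1, Finset.sum_range_add, Finset.sum_range_succ', ← Finset.sum_range_reflect, add_assoc,
    add_comm (hyperTerm p m / p)]
  congr 1
  · refine Finset.sum_congr rfl fun r hr => ?_
    have hr' := Finset.mem_range.mp hr
    rw [Nat.sub_sub, Nat.add_comm 1 r, Nat.cast_sub (by lia), hpq]
    push_cast
    ring_nf
  · congr 1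
    · refine Finset.sum_congr rfl fun r _ => ?_
      rw [hpq]
      push_cast
      ring_nf
    · rw [hpq, add_zero]

theorem harmonicSq_add_altHarmonicSq_cong {p m : ℕ} (hp : p.Prime) (hp3 : 3 < p)
    (hm : p = 2 * m + 1) :
    PCong p 1 ((-1) ^ m * 2⁻¹ ^ 2 * (harmonicSq m + 2 * altHarmonicSq m))
      (eulerNumber (p - 3)) := by
  subst hm
  have h2 := inv_two_mem_pIntegral hp (by lia)
  have h := ((harmonicSq_half_cong hp hp3).add
    ((altHarmonicSq_half_cong hp hp3).mul_left (ofNat_mem_pIntegral 2))).mul_left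
    (mul_mem (pow_mem (neg_mem (one_mem _)) m) (pow_mem h2 2))
  refine h.trans (PCong.of_eq ?_)
  have hs : (-1 : ℚ) ^ m * (-1) ^ m = 1 := by rw [← mul_pow]; simp
  linear_combination eulerNumber (2 * m + 1 - 3) * hs

theorem sum_hyperTerm_cong {p m : ℕ} (hp : p.Prime) (hp3 : 3 < p) (hm : p = 2 * m + 1) :
    PCong p 3 (p * ∑ j ∈ Finset.range p, hyperTerm p j / (2 * (j : ℚ) + 1))
      ((4 ^ m) ^ 2 * ((-1) ^ m + (p : ℚ) ^ 2 * eulerNumber (p - 3))) := by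
  have hp0 : (p : ℚ) ≠ 0 := by exact_mod_cast hp.ne_zero
  have h2 := inv_two_mem_pIntegral hp (by lia)
  have hpm : (p : ℚ) ∈ pIntegral p := natCast_mem _ p
  have hH := harmonic_mem_pIntegral hp (show m < p by lia)
  have hy := mul_mem hpm hH
  have hs : (-1 : ℚ) ^ m ∈ pIntegral p := pow_mem (neg_mem (one_mem _)) m
  have he := hyperTerm_half_cong hp hp3 hm
  have hA := (sum_hyperTerm_half_sub_cong hp hp3 hm).prime_pow_mul 1
  have hB := (sum_hyperTerm_half_add_cong hp hp3 hm).prime_pow_mul 1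
  have hD := harmonicSq_add_altHarmonicSq_cong hp hp3 hm
  have hw := four_pow_half_cong hp hp3 hm
  obtain ⟨z, hz⟩ := eulerNumber_eq_intCast (p - 3)
  have hE : eulerNumber (p - 3) ∈ pIntegral p := hz ▸ intCast_mem _ z
  have hss : (-1 : ℚ) ^ m * (-1) ^ m = 1 := by rw [← mul_pow]; simp
  have hleft : PCong p 3 (p * ∑ j ∈ Finset.range p, hyperTerm p j / (2 * (j : ℚ) + 1))
      (hyperTerm p m * (1 + p * harmonic m * 2⁻¹ + (p * harmonic m) ^ 2 * 2⁻¹ ^ 3) +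
        (p : ℚ) ^ 2 * (((-1) ^ m * 2⁻¹ ^ 2 * (harmonicSq m + 2 * altHarmonicSq m)) *
          (2 - hyperTerm p m * (-1) ^ m))) := by
    convert ((PCong.refl (hyperTerm p m)).add hA).add hB using 1
    · rw [sum_hyperTerm_div_split hm]
      field_simp
      ring
    · linear_combination -(p : ℚ) ^ 2 * 2⁻¹ ^ 2 * (harmonicSq m + 2 * altHarmonicSq m) *
        hyperTerm p m * hss
  have hq : 1 + p * harmonic m * 2⁻¹ + (p * harmonic m) ^ 2 * 2⁻¹ ^ 3 ∈ pIntegral p :=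
    add_mem (add_mem (one_mem _) (mul_mem hy h2)) (mul_mem (pow_mem hy 2) (pow_mem h2 3))
  have hmain := he.mul_right hq
  have hcorr : PCong p 1 (((-1) ^ m * 2⁻¹ ^ 2 * (harmonicSq m + 2 * altHarmonicSq m)) *
      (2 - hyperTerm p m * (-1) ^ m)) (eulerNumber (p - 3)) := by
    have h1 := (PCong.refl 2).add
      (((hyperTerm_half_cong_one hp hp3 hm).mul_right hs).mul_left (neg_mem (one_mem _)))
    have h3 := h1.mul_left (hD.mem_pIntegral hE)
    refine PCong.trans ?_ hD
    convert h3 using 1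
    · ring
    · rw [hss]
      ring
  refine (hleft.trans (hmain.add (hcorr.prime_pow_mul 2))).trans (PCong.symm ?_)
  have hw0 : 1 - p * harmonic m / 2 + (p * harmonic m) ^ 2 / 8 ∈ pIntegral p := by
    have e : 1 - p * harmonic m / 2 + (p * harmonic m) ^ 2 / 8 =
        1 - p * harmonic m * 2⁻¹ + (p * harmonic m) ^ 2 * 2⁻¹ ^ 3 := by ring
    rw [e]
    exact add_mem (sub_mem (one_mem _) (mul_mem hy h2)) (mul_mem (pow_mem hy 2) (pow_mem h2 3))
  rw [sq (4 ^ m : ℚ)]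
  refine ((hw.mul hw hw0 (hw.mem_pIntegral hw0)).mul_right
    (add_mem hs (mul_mem (pow_mem hpm 2) hE))).trans ?_
  refine ⟨(-1) ^ m * (-(harmonic m ^ 3 * 2⁻¹) - p * harmonic m ^ 4 * 2⁻¹ ^ 3) +
    eulerNumber (p - 3) * (-harmonic m + p * harmonic m ^ 2 * 2⁻¹ -
      p ^ 2 * harmonic m ^ 3 * 2⁻¹ ^ 3 + p ^ 3 * harmonic m ^ 4 * 2⁻¹ ^ 6),
    add_mem (mul_mem hs (sub_mem (neg_mem (mul_mem (pow_mem hH 3) h2))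
      (mul_mem (mul_mem hpm (pow_mem hH 4)) (pow_mem h2 3))))
      (mul_mem hE (add_mem (sub_mem (add_mem (neg_mem hH) (mul_mem (mul_mem hpm (pow_mem hH 2)) h2))
        (mul_mem (mul_mem (pow_mem hpm 2) (pow_mem hH 3)) (pow_mem h2 3)))
        (mul_mem (mul_mem (pow_mem hpm 3) (pow_mem hH 4)) (pow_mem h2 6)))), by ring⟩

/-- Conjecture 4.29 of Z.-H. Sun (Theorem 1.1): for a prime `p > 3`,
`∑_{k=0}^{p-1} C(2k,k) (3k+1)/(-16)^k f_k ≡ (-1)^((p-1)/2) p + p^3 E_{p-3} (mod p^4)`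
as rational numbers. -/
theorem sun_conjecture_4_29 (p : ℕ) (hp : p.Prime) (hp3 : 3 < p) :
    ((p : ℤ)) ^ 4 ∣
      ((∑ k ∈ Finset.range p,
          ((2 * k).choose k : ℚ) * (3 * (k : ℚ) + 1) / (-16) ^ k * (franel k : ℚ)) -
        ((-1) ^ ((p - 1) / 2) * (p : ℚ) + (p : ℚ) ^ 3 * eulerNumber (p - 3))).num := by
  obtain ⟨m, hm⟩ : ∃ m, p = 2 * m + 1 := hp.odd_of_ne_two (by lia)
  have hS := sum_hyperTerm_cong hp hp3 hm
  have hw0 : ((4 : ℚ) ^ m) ^ 2 ≠ 0 := by positivity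
  have hwi : (((4 : ℚ) ^ m) ^ 2)⁻¹ ∈ pIntegral p := by
    have e : (((4 : ℚ) ^ m) ^ 2)⁻¹ = 2⁻¹ ^ (2 * m * 2) := by
      rw [← pow_mul, inv_pow, pow_mul, pow_mul, pow_mul]
      norm_num
    rw [e]
    exact pow_mem (inv_two_mem_pIntegral hp (by lia)) _
  obtain ⟨z, hz⟩ := eulerNumber_eq_intCast (p - 3)
  have hE : eulerNumber (p - 3) ∈ pIntegral p := hz ▸ intCast_mem _ z
  have hR : (4 ^ m) ^ 2 * ((-1) ^ m + (p : ℚ) ^ 2 * eulerNumber (p - 3)) ∈ pIntegral p :=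
    mul_mem (pow_mem (pow_mem (ofNat_mem_pIntegral 4) m) 2) (add_mem
      (pow_mem (neg_mem (one_mem _)) m) (mul_mem (pow_mem (natCast_mem _ p) 2) hE))
  have h := (((choose_two_mul_prime_cong hp hp3).mul hS (one_mem _)
    (hS.mem_pIntegral hR)).mul_right hwi).prime_pow_mul 1
  have hm2 : (p - 1) / 2 = m := by lia
  refine PCong.dvd_num (n := 4) ?_
  rw [sum_choose_mul_franel, hm2]
  have h4 : (4 : ℚ) ^ p = 4 * (4 ^ m) ^ 2 := by
    rw [hm, pow_succ, mul_comm 2 m, pow_mul, mul_comm]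
  rw [h4]
  convert h using 1
  · field_simp
    ring
  · field_simp
end

section
/- Let p > 3 be a prime. Then the sum over k from 0 to p-1 of (2k+1) * T_k / 4^k is congruent to p + (7/6) * p^4 * B_{p-3} modulo p^5, where the congruence is understood in the rational numbers. -/
/-- The Apéry-like numbers `T n = ∑ k ≤ n, (n.choose k)^2 * ((2k).choose n)^2`. -/
def apT (n : ℕ) : ℕ := ∑ k ∈ Finset.range (n + 1), (n.choose k) ^ 2 * ((2 * k).choose n) ^ 2

open Finset

/-- The reciprocal factorial `1 / m!`, extended by zero to negative integers. -/
def invFactorial (m : ℤ) : ℚ := if m < 0 then 0 else 1 / (m.toNat.factorial : ℚ)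

lemma invFactorial_of_neg {m : ℤ} (h : m < 0) : invFactorial m = 0 := if_pos h

lemma invFactorial_natCast (m : ℕ) : invFactorial (m : ℤ) = 1 / (m.factorial : ℚ) := by
  simp [invFactorial]

lemma invFactorial_sub_one (m : ℤ) : invFactorial (m - 1) = m * invFactorial m := by
  rcases lt_trichotomy m 0 with h | rfl | h
  · rw [invFactorial_of_neg h, invFactorial_of_neg (by omega), mul_zero]
  · simp [invFactorial]
  · obtain ⟨k, rfl⟩ : ∃ k : ℕ, m = (k : ℤ) + 1 := ⟨(m - 1).toNat, by omega⟩
    rw [add_sub_cancel_right, invFactorial_natCast, ← Nat.cast_succ, invFactorial_natCast,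
      Nat.factorial_succ]
    push_cast
    field_simp

lemma invFactorial_eq_mul_add_one (m : ℤ) :
    invFactorial m = (m + 1) * invFactorial (m + 1) := by
  simpa using invFactorial_sub_one (m + 1)

/-- The summand `(n.choose k)^2 * ((2k).choose n)^2` of `apT n`, in a form that is
hypergeometric for all values of the arguments. -/
def apTTerm (n k : ℕ) : ℚ :=
  ((2 * k).factorial * invFactorial k * invFactorial ((n : ℤ) - k) *
    invFactorial (2 * (k : ℤ) - n)) ^ 2

lemma choose_eq_invFactorial (n k : ℕ) :
    (n.choose k : ℚ) = n.factorial * invFactorial k * invFactorial ((n : ℤ) - k) := by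
  rcases le_or_gt k n with h | h
  · rw [← Nat.cast_sub h, invFactorial_natCast, invFactorial_natCast, Nat.cast_choose ℚ h]
    field_simp
  · rw [Nat.choose_eq_zero_of_lt h, invFactorial_of_neg (m := (n : ℤ) - k) (by omega)]
    simp

lemma apTTerm_eq (n k : ℕ) :
    apTTerm n k = (n.choose k : ℚ) ^ 2 * ((2 * k).choose n : ℚ) ^ 2 := by
  rw [choose_eq_invFactorial, choose_eq_invFactorial, invFactorial_natCast n, apTTerm]
  push_cast
  field_simp

lemma apTTerm_eq_zero {n k : ℕ} (h : n < k) : apTTerm n k = 0 := by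
  rw [apTTerm, invFactorial_of_neg (m := (n : ℤ) - k) (by omega)]
  simp

lemma sum_apTTerm {n N : ℕ} (h : n < N) : ∑ k ∈ range N, apTTerm n k = apT n := by
  rw [apT]
  push_cast
  simp_rw [← apTTerm_eq]
  refine (sum_subset (range_subset_range.2 (by omega)) fun k _ hk ↦ apTTerm_eq_zero ?_).symm
  simpa using hk

/-- The telescoping companion of `apTTerm` in the creative-telescoping proof of the recurrence
for `apT`. -/
def apTCertificate (n k : ℕ) : ℚ :=
  (4 * (2 * n + 1) * k ^ 2 - 8 * (2 * n + 1) * (n + 1) * k + (n + 1) ^ 2 * (7 * n + 3)) *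
    ((2 * k).factorial * invFactorial k * invFactorial ((n : ℤ) + 1 - k) *
      invFactorial (2 * (k : ℤ) - n - 1)) ^ 2

lemma apTTerm_recurrence (n k : ℕ) :
    ((n : ℚ) + 2) ^ 3 * apTTerm (n + 2) k
      - 4 * (2 * n + 3) * (3 * (n + 1) ^ 2 + 3 * (n + 1) + 1) * apTTerm (n + 1) k
      + 16 * (n + 1) ^ 3 * apTTerm n k
      = apTCertificate (n + 1) (k + 1) - apTCertificate (n + 1) k := by
  have hk : invFactorial k = (k + 1) * invFactorial ((k : ℤ) + 1) :=
    mod_cast invFactorial_eq_mul_add_one k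
  have a1 := invFactorial_eq_mul_add_one ((n : ℤ) + 1 - k)
  have a2 := invFactorial_eq_mul_add_one ((n : ℤ) - k)
  have b1 := invFactorial_eq_mul_add_one (2 * (k : ℤ) - n - 1)
  have b2 := invFactorial_eq_mul_add_one (2 * (k : ℤ) - n - 2)
  have e1 : (n : ℤ) - k + 1 = n + 1 - k := by ring
  have e2 : (n : ℤ) + 1 - k + 1 = n + 2 - k := by ring
  have e3 : 2 * (k : ℤ) - n - 2 + 1 = 2 * k - n - 1 := by ring
  have e4 : 2 * (k : ℤ) - n - 1 + 1 = 2 * k - n := by ring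
  rw [e2] at a1
  rw [e1, a1] at a2
  rw [e4] at b1
  rw [e3, b1] at b2
  have hf : ((2 * (k + 1)).factorial : ℚ) = (2 * k + 2) * (2 * k + 1) * (2 * k).factorial := by
    rw [show 2 * (k + 1) = 2 * k + 1 + 1 by ring, Nat.factorial_succ, Nat.factorial_succ]
    push_cast
    ring
  simp only [apTTerm, apTCertificate, hf]
  push_cast
  rw [show (n : ℤ) + 1 + 1 - (k + 1) = n + 1 - k by ring,
    show (n : ℤ) + 1 + 1 - k = n + 2 - k by ring,
    show 2 * ((k : ℤ) + 1) - (n + 1) - 1 = 2 * k - n by ring,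
    show 2 * (k : ℤ) - (n + 1) - 1 = 2 * k - n - 2 by ring,
    show 2 * (k : ℤ) - (n + 1) = 2 * k - n - 1 by ring,
    show 2 * (k : ℤ) - (n + 2) = 2 * k - n - 2 by ring, a2, a1, b2, b1, hk]
  push_cast
  ring

lemma apT_recurrence (n : ℕ) :
    ((n : ℚ) + 2) ^ 3 * apT (n + 2)
      - 4 * (2 * n + 3) * (3 * (n + 1) ^ 2 + 3 * (n + 1) + 1) * apT (n + 1)
      + 16 * (n + 1) ^ 3 * apT n = 0 := by
  rw [← sum_apTTerm (show n + 2 < n + 3 by omega), ← sum_apTTerm (show n + 1 < n + 3 by omega),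
    ← sum_apTTerm (show n < n + 3 by omega), mul_sum, mul_sum, mul_sum, ← sum_sub_distrib,
    ← sum_add_distrib, sum_congr rfl fun k _ ↦ apTTerm_recurrence n k, sum_range_sub]
  rw [apTCertificate, apTCertificate,
    invFactorial_of_neg (m := ((n + 1 : ℕ) : ℤ) + 1 - (n + 3 : ℕ)) (by push_cast; omega),
    invFactorial_of_neg (m := 2 * ((0 : ℕ) : ℤ) - (n + 1 : ℕ) - 1) (by push_cast; omega)]
  ring

/-- The summand of the expansion of `apT n / 4 ^ n`. -/
def evenTerm (n k : ℕ) : ℚ :=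
  (n + 2 * k).factorial * invFactorial ((n : ℤ) - 2 * k) * invFactorial k ^ 4 / 16 ^ k

lemma evenTerm_eq_zero {n k : ℕ} (h : n < 2 * k) : evenTerm n k = 0 := by
  rw [evenTerm, invFactorial_of_neg (m := (n : ℤ) - 2 * k) (by omega)]
  simp

lemma evenTerm_zero_right (n : ℕ) : evenTerm n 0 = 1 := by
  have h : invFactorial ((n : ℤ) - 2 * (0 : ℕ)) = 1 / n.factorial := by
    rw [← invFactorial_natCast]; simp
  rw [evenTerm, h, invFactorial_natCast]
  simp [Nat.factorial_ne_zero]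

/-- The telescoping companion of `evenTerm`. -/
def evenCertificate (n k : ℕ) : ℚ :=
  -32 * (2 * n + 3) * k ^ 4 * ((n + 2 * k).factorial * invFactorial ((n : ℤ) + 2 - 2 * k) *
    invFactorial k ^ 4 / 16 ^ k)

lemma evenTerm_recurrence (n k : ℕ) :
    ((n : ℚ) + 2) ^ 3 * evenTerm (n + 2) k
      - (2 * n + 3) * (3 * (n + 1) ^ 2 + 3 * (n + 1) + 1) * evenTerm (n + 1) k
      + (n + 1) ^ 3 * evenTerm n k
      = evenCertificate n (k + 1) - evenCertificate n k := by
  have hk : invFactorial k = (k + 1) * invFactorial ((k : ℤ) + 1) :=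
    mod_cast invFactorial_eq_mul_add_one k
  have a1 := invFactorial_eq_mul_add_one ((n : ℤ) + 1 - 2 * k)
  have a2 := invFactorial_eq_mul_add_one ((n : ℤ) - 2 * k)
  have e1 : (n : ℤ) - 2 * k + 1 = n + 1 - 2 * k := by ring
  have e2 : (n : ℤ) + 1 - 2 * k + 1 = n + 2 - 2 * k := by ring
  rw [e2] at a1
  rw [e1, a1] at a2
  have f1 : ((n + 1 + 2 * k).factorial : ℚ) = (n + 2 * k + 1) * (n + 2 * k).factorial := by
    rw [show n + 1 + 2 * k = n + 2 * k + 1 by ring, Nat.factorial_succ]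
    push_cast
    ring
  have f2 : ((n + 2 + 2 * k).factorial : ℚ) =
      (n + 2 * k + 2) * (n + 2 * k + 1) * (n + 2 * k).factorial := by
    rw [show n + 2 + 2 * k = n + 2 * k + 1 + 1 by ring, Nat.factorial_succ, Nat.factorial_succ]
    push_cast
    ring
  simp only [evenTerm, evenCertificate, show n + 2 * (k + 1) = n + 2 + 2 * k by ring, f1, f2]
  push_cast
  rw [show (n : ℤ) + 2 - 2 * (k + 1) = n - 2 * k by ring, a2, a1, hk, pow_succ (16 : ℚ)]
  push_cast
  field_simp
  ring

lemma sum_evenTerm_recurrence {n N : ℕ} (h : n + 2 < 2 * N) :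
    ((n : ℚ) + 2) ^ 3 * ∑ k ∈ range N, evenTerm (n + 2) k
      - (2 * n + 3) * (3 * (n + 1) ^ 2 + 3 * (n + 1) + 1) * ∑ k ∈ range N, evenTerm (n + 1) k
      + (n + 1) ^ 3 * ∑ k ∈ range N, evenTerm n k = 0 := by
  rw [mul_sum, mul_sum, mul_sum, ← sum_sub_distrib, ← sum_add_distrib,
    sum_congr rfl fun k _ ↦ evenTerm_recurrence n k, sum_range_sub, evenCertificate,
    evenCertificate, invFactorial_of_neg (m := (n : ℤ) + 2 - 2 * N) (by omega)]
  simp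

theorem apT_div_four_pow_eq_sum {n N : ℕ} (h : n < 2 * N) :
    (apT n : ℚ) / 4 ^ n = ∑ k ∈ range N, evenTerm n k := by
  induction n using Nat.strong_induction_on with
  | _ n ih =>
    obtain ⟨N, rfl⟩ : ∃ M, N = M + 1 := ⟨N - 1, by omega⟩
    rcases n with _ | _ | n
    · rw [sum_range_succ', sum_eq_zero fun k _ ↦ evenTerm_eq_zero (by omega), evenTerm_zero_right]
      simp [apT]
    · rw [sum_range_succ', sum_eq_zero fun k _ ↦ evenTerm_eq_zero (by omega), evenTerm_zero_right]
      simp [apT, sum_range_succ]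
    · have h0 := ih n (by omega) (by omega)
      have h1 := ih (n + 1) (by omega) (by omega)
      have hrec := sum_evenTerm_recurrence h
      rw [← h0, ← h1] at hrec
      have hT := apT_recurrence n
      have hn : ((n : ℚ) + 2) ^ 3 ≠ 0 := by positivity
      refine mul_left_cancel₀ hn ?_
      linear_combination (1 / 4 ^ (n + 2)) * hT - hrec

lemma sum_odd_mul_evenTerm (N k : ℕ) :
    ∑ n ∈ range N, (2 * (n : ℚ) + 1) * evenTerm n k =
      N * (N - 2 * k) / (2 * k + 1) * evenTerm N k := by
  induction N with
  | zero => simp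
  | succ n ih =>
    have hsucc : ((n : ℚ) + 1 - 2 * k) * evenTerm (n + 1) k = (n + 1 + 2 * k) * evenTerm n k := by
      have a := invFactorial_eq_mul_add_one ((n : ℤ) - 2 * k)
      rw [show (n : ℤ) - 2 * k + 1 = n + 1 - 2 * k by ring] at a
      simp only [evenTerm, show n + 1 + 2 * k = n + 2 * k + 1 by ring, Nat.factorial_succ]
      push_cast
      rw [a]
      push_cast
      ring
    rw [sum_range_succ, ih]
    push_cast
    have hk : (2 * (k : ℚ) + 1) ≠ 0 := by positivity
    field_simp
    linear_combination (-((n : ℚ) + 1)) * hsucc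

/-- The coefficient `(-1)^k * n.choose k * (n + k).choose k` of the shifted Legendre polynomial. -/
def legendreCoeff (n k : ℕ) : ℚ := (-1) ^ k * n.choose k * (n + k).choose k

lemma legendreCoeff_zero_right (n : ℕ) : legendreCoeff n 0 = 1 := by simp [legendreCoeff]

lemma legendreCoeff_eq_invFactorial (n k : ℕ) :
    legendreCoeff n k =
      (-1) ^ k * (n + k).factorial * invFactorial ((n : ℤ) - k) * invFactorial k ^ 2 := by
  rw [legendreCoeff, choose_eq_invFactorial, choose_eq_invFactorial,
    show ((n + k : ℕ) : ℤ) - k = n by push_cast; ring, invFactorial_natCast n]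
  field_simp

lemma legendreCoeff_succ_right (n k : ℕ) :
    ((k : ℚ) + 1) ^ 2 * legendreCoeff n (k + 1) = -((n - k) * (n + k + 1)) * legendreCoeff n k := by
  have hk : invFactorial k = (k + 1) * invFactorial ((k : ℤ) + 1) :=
    mod_cast invFactorial_eq_mul_add_one k
  have a := invFactorial_sub_one ((n : ℤ) - k)
  simp only [legendreCoeff_eq_invFactorial, ← add_assoc, Nat.factorial_succ]
  push_cast
  rw [show (n : ℤ) - (k + 1) = n - k - 1 by ring, a, hk]
  push_cast
  ring

lemma legendreCoeff_succ_left (n k : ℕ) :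
    ((n : ℚ) + 1 - k) * legendreCoeff (n + 1) k = (n + 1 + k) * legendreCoeff n k := by
  have a := invFactorial_eq_mul_add_one ((n : ℤ) - k)
  rw [show (n : ℤ) - k + 1 = n + 1 - k by ring] at a
  simp only [legendreCoeff_eq_invFactorial, show n + 1 + k = n + k + 1 by ring,
    Nat.factorial_succ]
  push_cast
  rw [a]
  push_cast
  ring

lemma evenTerm_odd_eq (n k : ℕ) :
    (2 * (n : ℚ) + 1 - 2 * k) * evenTerm (2 * n + 1) k =
      (2 * n + 1) * (legendreCoeff n k *
        ∏ j ∈ range k, (1 - (2 * (n : ℚ) + 1) ^ 2 * (1 / (4 * ((j : ℚ) + 1) ^ 2)))) := by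
  induction k with
  | zero => simp [evenTerm_zero_right, legendreCoeff_zero_right]
  | succ k ih =>
    have hE : 16 * ((k : ℚ) + 1) ^ 4 * evenTerm (2 * n + 1) (k + 1) =
        (2 * n + 1 + 2 * k + 2) * (2 * n + 1 + 2 * k + 1) * (2 * n + 1 - 2 * k) *
          (2 * n - 2 * k) * evenTerm (2 * n + 1) k := by
      have hk : invFactorial k = (k + 1) * invFactorial ((k : ℤ) + 1) :=
        mod_cast invFactorial_eq_mul_add_one k
      have a1 := invFactorial_sub_one (2 * (n : ℤ) + 1 - 2 * k)
      have a2 := invFactorial_sub_one (2 * (n : ℤ) + 1 - 2 * k - 1)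
      rw [a1] at a2
      simp only [evenTerm, show 2 * n + 1 + 2 * (k + 1) = 2 * n + 1 + 2 * k + 1 + 1 by ring,
        Nat.factorial_succ]
      push_cast
      rw [show 2 * (n : ℤ) + 1 - 2 * (k + 1) = 2 * n + 1 - 2 * k - 1 - 1 by ring, a2, hk,
        pow_succ (16 : ℚ)]
      push_cast
      field_simp
      ring
    have hD := legendreCoeff_succ_right n k
    rw [prod_range_succ]
    push_cast
    set P := ∏ j ∈ range k, (1 - (2 * (n : ℚ) + 1) ^ 2 * (1 / (4 * ((j : ℚ) + 1) ^ 2)))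
    have hk : 16 * ((k : ℚ) + 1) ^ 4 ≠ 0 := by positivity
    refine mul_left_cancel₀ hk ?_
    have hk1 : (k : ℚ) + 1 ≠ 0 := by positivity
    have hfac : 4 * ((k : ℚ) + 1) ^ 2 *
        (1 - (2 * (n : ℚ) + 1) ^ 2 * (1 / (4 * ((k : ℚ) + 1) ^ 2))) =
        4 * (k + 1) ^ 2 - (2 * n + 1) ^ 2 := by
      field_simp
    linear_combination (2 * (n : ℚ) + 1 - 2 * (k + 1)) * hE +
      (2 * n + 1 - 2 * (k + 1)) * (2 * n + 1 + 2 * k + 2) * (2 * n + 1 + 2 * k + 1) *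
          (2 * n - 2 * k) * ih
      - (2 * n + 1) * P * 4 * (4 * (k + 1) ^ 2 - (2 * n + 1) ^ 2) * hD
      - (2 * n + 1) * P * legendreCoeff n (k + 1) * 4 * (k + 1) ^ 2 * hfac

theorem sum_odd_mul_apT (n : ℕ) :
    ∑ k ∈ range (2 * n + 1), (2 * (k : ℚ) + 1) * (apT k : ℚ) / 4 ^ k =
      (2 * n + 1) ^ 2 * ∑ k ∈ range (n + 1), legendreCoeff n k / (2 * k + 1) *
        ∏ j ∈ range k, (1 - (2 * (n : ℚ) + 1) ^ 2 * (1 / (4 * ((j : ℚ) + 1) ^ 2))) := by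
  have h : ∀ m ∈ range (2 * n + 1), (2 * (m : ℚ) + 1) * (apT m : ℚ) / 4 ^ m =
      ∑ k ∈ range (n + 1), (2 * (m : ℚ) + 1) * evenTerm m k := fun m hm ↦ by
    rw [mul_div_assoc, apT_div_four_pow_eq_sum (N := n + 1) (by have := mem_range.1 hm; omega),
      mul_sum]
  rw [sum_congr rfl h, sum_comm, mul_sum]
  refine sum_congr rfl fun k _ ↦ ?_
  rw [sum_odd_mul_evenTerm]
  have hk : (2 * (k : ℚ) + 1) ≠ 0 := by positivity
  have := evenTerm_odd_eq n k
  generalize ∏ j ∈ range k, (1 - (2 * (n : ℚ) + 1) ^ 2 * (1 / (4 * ((j : ℚ) + 1) ^ 2))) = P at *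
  push_cast
  field_simp
  linear_combination this

/-- The generalized harmonic number `∑ j ≤ k, 1 / j ^ s`. -/
def harmonicPow (s k : ℕ) : ℚ := ∑ j ∈ range k, 1 / ((j : ℚ) + 1) ^ s

lemma legendreCoeff_eq_zero {n k : ℕ} (h : n < k) : legendreCoeff n k = 0 := by
  simp [legendreCoeff, Nat.choose_eq_zero_of_lt h]

/-- The summand `(-1)^k * (n + 1).choose k * (n + k).choose k`. -/
def diffCoeff (n k : ℕ) : ℚ := (n + 1) / (n + 1 + k) * legendreCoeff (n + 1) k

lemma diffCoeff_succ (n k : ℕ) :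
    ((k : ℚ) + 1) ^ 2 * diffCoeff n (k + 1) = (k ^ 2 - (n + 1) ^ 2) * diffCoeff n k := by
  have h := legendreCoeff_succ_right (n + 1) k
  have h1 : (n : ℚ) + 1 + k ≠ 0 := by positivity
  have h2 : (n : ℚ) + 1 + (k + 1) ≠ 0 := by positivity
  rw [diffCoeff, diffCoeff]
  push_cast at h ⊢
  field_simp
  linear_combination (n + 1 + (k : ℚ)) * h

lemma sub_legendreCoeff (n k : ℕ) :
    (2 * (n : ℚ) + 3) * (legendreCoeff (n + 1) k / (2 * k + 1)) -
      (2 * n + 1) * (legendreCoeff n k / (2 * k + 1)) = 2 * diffCoeff n k := by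
  have h := legendreCoeff_succ_left n k
  have h1 : (n : ℚ) + 1 + k ≠ 0 := by positivity
  have hk : (2 * (k : ℚ) + 1) ≠ 0 := by positivity
  rw [diffCoeff]
  field_simp
  linear_combination (2 * n + 1) * h

lemma sum_diffCoeff (n k : ℕ) :
    ((n : ℚ) + 1) ^ 2 * ∑ i ∈ range k, diffCoeff n i = -(k ^ 2 * diffCoeff n k) := by
  induction k with
  | zero => simp
  | succ k ih =>
    rw [sum_range_succ, mul_add, ih]
    push_cast
    linear_combination diffCoeff_succ n k

lemma sum_diffCoeff_mul_harmonicPow (n k : ℕ) :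
    ((n : ℚ) + 1) ^ 2 * ∑ i ∈ range k, diffCoeff n i * harmonicPow 2 i =
      -(k ^ 2 * diffCoeff n k * harmonicPow 2 k) + ∑ i ∈ range k, diffCoeff n (i + 1) := by
  induction k with
  | zero => simp
  | succ k ih =>
    have hk : (k : ℚ) + 1 ≠ 0 := by positivity
    have hH : ((k : ℚ) + 1) ^ 2 * harmonicPow 2 (k + 1) =
        (k + 1) ^ 2 * harmonicPow 2 k + 1 := by
      rw [harmonicPow, sum_range_succ, ← harmonicPow]
      field_simp
    rw [sum_range_succ, mul_add, ih, sum_range_succ]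
    push_cast
    linear_combination diffCoeff n (k + 1) * hH + harmonicPow 2 k * diffCoeff_succ n k

lemma diffCoeff_zero (n : ℕ) : diffCoeff n 0 = 1 := by
  have : (n : ℚ) + 1 ≠ 0 := by positivity
  simp [diffCoeff, legendreCoeff_zero_right, this]

lemma diffCoeff_eq_zero {n k : ℕ} (h : n + 1 < k) : diffCoeff n k = 0 := by
  simp [diffCoeff, legendreCoeff_eq_zero h]

lemma odd_mul_sum_legendreCoeff_mul_succ (n : ℕ) (f : ℕ → ℚ) :
    (2 * (n : ℚ) + 3) * ∑ k ∈ range (n + 2), legendreCoeff (n + 1) k / (2 * k + 1) * f k =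
      (2 * n + 1) * ∑ k ∈ range (n + 1), legendreCoeff n k / (2 * k + 1) * f k +
        2 * ∑ k ∈ range (n + 2), diffCoeff n k * f k := by
  have h0 : ∑ k ∈ range (n + 1), legendreCoeff n k / (2 * k + 1) * f k =
      ∑ k ∈ range (n + 2), legendreCoeff n k / (2 * k + 1) * f k := by
    rw [sum_range_succ _ (n + 1), legendreCoeff_eq_zero (Nat.lt_succ_self n)]
    simp
  rw [h0, mul_sum, mul_sum, mul_sum, ← sum_add_distrib]
  exact sum_congr rfl fun k _ ↦ by linear_combination f k * sub_legendreCoeff n k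

lemma sum_legendreCoeff_div (n : ℕ) :
    (2 * (n : ℚ) + 1) * ∑ k ∈ range (n + 1), legendreCoeff n k / (2 * k + 1) = 1 := by
  induction n with
  | zero => simp [legendreCoeff_zero_right]
  | succ n ih =>
    have h := odd_mul_sum_legendreCoeff_mul_succ n 1
    have hs := sum_diffCoeff n (n + 2)
    rw [diffCoeff_eq_zero (by omega), mul_zero, neg_zero, mul_eq_zero,
      or_iff_right (by positivity)] at hs
    simp only [Pi.one_apply, mul_one, ih, hs] at h
    push_cast
    linear_combination h

lemma sum_legendreCoeff_div_mul_harmonicPow (n : ℕ) :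
    (2 * (n : ℚ) + 1) * ∑ k ∈ range (n + 1), legendreCoeff n k / (2 * k + 1) * harmonicPow 2 k =
      -2 * harmonicPow 2 n := by
  induction n with
  | zero => simp [harmonicPow]
  | succ n ih =>
    have h := odd_mul_sum_legendreCoeff_mul_succ n (harmonicPow 2)
    have hs := sum_diffCoeff n (n + 3)
    have hH := sum_diffCoeff_mul_harmonicPow n (n + 2)
    have hn : ((n : ℚ) + 1) ^ 2 ≠ 0 := by positivity
    rw [diffCoeff_eq_zero (by omega), mul_zero, neg_zero, mul_eq_zero,
      or_iff_right hn, sum_range_succ', diffCoeff_zero] at hs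
    rw [diffCoeff_eq_zero (by omega), eq_neg_of_add_eq_zero_left hs] at hH
    rw [ih] at h
    have hsucc : harmonicPow 2 (n + 1) = harmonicPow 2 n + 1 / ((n : ℚ) + 1) ^ 2 :=
      sum_range_succ _ n
    have hH' : ∑ i ∈ range (n + 2), diffCoeff n i * harmonicPow 2 i = -(1 / ((n : ℚ) + 1) ^ 2) := by
      field_simp
      linear_combination hH
    rw [hH'] at h
    rw [hsucc]
    push_cast
    linear_combination h

section PIntegral

variable {p : ℕ} [hp : Fact p.Prime]

/-- The ring of `p`-integral rational numbers. -/
abbrev pIntegers (p : ℕ) [Fact p.Prime] : Subring ℚ := (Rat.padicValuation p).integer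

lemma mem_pIntegers_iff {x : ℚ} : x ∈ pIntegers p ↔ ¬ p ∣ x.den :=
  Rat.padicValuation_le_one_iff

lemma one_div_natCast_mem {a : ℕ} (h : ¬ p ∣ a) : 1 / (a : ℚ) ∈ pIntegers p := by
  rw [mem_pIntegers_iff]
  rcases Nat.eq_zero_or_pos a with rfl | ha
  · simp at h
  · rwa [one_div, Rat.inv_natCast_den_of_pos ha]

lemma one_div_natCast_mem_of_lt {a : ℕ} (h0 : 0 < a) (h : a < p) : 1 / (a : ℚ) ∈ pIntegers p :=
  one_div_natCast_mem (Nat.not_dvd_of_pos_of_lt h0 h)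

lemma pow_dvd_num {r : ℕ} {x y : ℚ} (hy : y ∈ pIntegers p) (h : x = (p : ℚ) ^ r * y) :
    (p : ℤ) ^ r ∣ x.num := by
  have hcop : IsCoprime ((p : ℤ) ^ r) (y.den : ℤ) := by
    refine IsCoprime.pow_left (Nat.isCoprime_iff_coprime.2 ?_)
    exact (Nat.Prime.coprime_iff_not_dvd hp.out).2 (mem_pIntegers_iff.1 hy)
  have hmul : x.num * (y.den : ℤ) = (p : ℤ) ^ r * (y.num * x.den) := by
    have hx : (x.den : ℚ) ≠ 0 := by simp
    have hy' : (y.den : ℚ) ≠ 0 := by simp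
    have h' : (x.num : ℚ) / x.den = (p : ℚ) ^ r * (y.num / y.den) := by
      rw [Rat.num_div_den, Rat.num_div_den, h]
    field_simp at h'
    have : (x.num : ℚ) * y.den = (p : ℚ) ^ r * (y.num * x.den) := by linear_combination h'
    exact_mod_cast this
  exact hcop.dvd_of_dvd_mul_right ⟨_, hmul⟩

lemma bernoulli_mem_pIntegers {m : ℕ} (h : m + 1 < p) : bernoulli m ∈ pIntegers p := by
  induction m using Nat.strong_induction_on with
  | _ m ih =>
    have hs := sum_bernoulli (m + 1)
    rw [sum_range_succ, Nat.choose_succ_self_right] at hs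
    have hm : ((m + 1 : ℕ) : ℚ) ≠ 0 := by positivity
    have : bernoulli m = 1 / ((m + 1 : ℕ) : ℚ) * ((if m + 1 = 1 then 1 else 0) -
        ∑ k ∈ range m, ((m + 1).choose k : ℚ) * bernoulli k) := by
      rw [← hs]
      field_simp
      ring
    rw [this]
    refine mul_mem (one_div_natCast_mem_of_lt (by omega) h) (sub_mem ?_ (sum_mem fun k hk ↦ ?_))
    · split_ifs
      exacts [one_mem _, zero_mem _]
    · have := mem_range.1 hk
      exact mul_mem (natCast_mem _ _) (ih k this (by omega))

lemma sum_pow_sub_bernoulli {m : ℕ} (h : m + 1 < p) :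
    ∃ z ∈ pIntegers p, ∑ k ∈ range p, (k : ℚ) ^ m = p * bernoulli m + (p : ℚ) ^ 2 * z := by
  refine ⟨∑ i ∈ range m, bernoulli i * ((m + 1).choose i) * (p : ℚ) ^ (m - 1 - i) *
    (1 / ((m + 1 : ℕ) : ℚ)), sum_mem fun i hi ↦ ?_, ?_⟩
  · have := mem_range.1 hi
    exact mul_mem (mul_mem (mul_mem (bernoulli_mem_pIntegers (by omega)) (natCast_mem _ _))
      (pow_mem (natCast_mem _ _) _)) (one_div_natCast_mem_of_lt (by omega) h)
  · rw [sum_range_pow, sum_range_succ, Nat.choose_succ_self_right, mul_sum, add_comm]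
    congr 1
    · have hm : (m : ℚ) + 1 ≠ 0 := by positivity
      rw [show m + 1 - m = 1 by omega]
      push_cast
      field_simp
    · refine sum_congr rfl fun i hi ↦ ?_
      have := mem_range.1 hi
      rw [show m + 1 - i = m - 1 - i + 2 by omega, pow_add]
      push_cast
      ring

end PIntegral

lemma sum_range_two_mul_reflect (f : ℕ → ℚ) (n : ℕ) :
    ∑ j ∈ range (2 * n), f (j + 1) =
      ∑ i ∈ range n, (f (i + 1) + f (2 * n + 1 - (i + 1))) := by
  rw [two_mul, sum_range_add, sum_add_distrib, ← sum_range_reflect (fun i ↦ f (n + i + 1))]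
  congr 1
  refine sum_congr rfl fun i hi ↦ ?_
  have := mem_range.1 hi
  congr 1
  omega

lemma sum_range_two_mul_even_reflect (f : ℕ → ℚ) (n : ℕ) :
    ∑ j ∈ range (2 * n), f (j + 1) =
      ∑ i ∈ range n, (f (2 * (i + 1)) + f (2 * n + 1 - 2 * (i + 1))) := by
  have h : ∑ j ∈ range (2 * n), f (j + 1) =
      ∑ i ∈ range n, f (2 * (i + 1)) + ∑ i ∈ range n, f (2 * i + 1) := by
    induction n with
    | zero => simp
    | succ n ih =>
      rw [show 2 * (n + 1) = 2 * n + 1 + 1 by ring, sum_range_succ, sum_range_succ, ih,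
        sum_range_succ, sum_range_succ, show 2 * (n + 1) = 2 * n + 1 + 1 by ring]
      ring
  rw [h, sum_add_distrib, ← sum_range_reflect (fun i ↦ f (2 * i + 1))]
  congr 1
  refine sum_congr rfl fun i hi ↦ ?_
  have := mem_range.1 hi
  congr 1
  omega

section Congruences

variable {n : ℕ} [hp : Fact (2 * n + 1).Prime]

lemma sum_reflect_congr {ι : Type*} (s : Finset ι) (a : ι → ℕ) {f g : ℕ → ℚ}
    (hfg : ∀ i ∈ s, ∃ z ∈ pIntegers (2 * n + 1),
      f (2 * n + 1 - a i) = f (a i) + (2 * n + 1) * g (a i) + (2 * n + 1) ^ 2 * z) :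
    ∃ z ∈ pIntegers (2 * n + 1), ∑ i ∈ s, (f (a i) + f (2 * n + 1 - a i)) =
      2 * ∑ i ∈ s, f (a i) + (2 * n + 1) * ∑ i ∈ s, g (a i) + (2 * n + 1) ^ 2 * z := by
  choose! z hz hf using hfg
  refine ⟨∑ i ∈ s, z i, sum_mem hz, ?_⟩
  rw [mul_sum, mul_sum, mul_sum, ← sum_add_distrib, ← sum_add_distrib]
  exact sum_congr rfl fun i hi ↦ by rw [hf i hi]; ring

/-- If `f (p - a) ≡ f a + p * g a` modulo `p ^ 2`, the sum of `f` over `0 < j < p` may be computed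
by pairing `j` with `p - j`, taking `j` to be either small or even. -/
lemma sum_congr_half_and_even {f g : ℕ → ℚ}
    (hfg : ∀ a, 0 < a → a < 2 * n + 1 → ∃ z ∈ pIntegers (2 * n + 1),
      f (2 * n + 1 - a) = f a + (2 * n + 1) * g a + (2 * n + 1) ^ 2 * z) :
    (∃ z ∈ pIntegers (2 * n + 1), ∑ j ∈ range (2 * n), f (j + 1) =
      2 * ∑ i ∈ range n, f (i + 1) + (2 * n + 1) * ∑ i ∈ range n, g (i + 1) +
        (2 * n + 1) ^ 2 * z) ∧
    (∃ z ∈ pIntegers (2 * n + 1), ∑ j ∈ range (2 * n), f (j + 1) =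
      2 * ∑ i ∈ range n, f (2 * (i + 1)) + (2 * n + 1) * ∑ i ∈ range n, g (2 * (i + 1)) +
        (2 * n + 1) ^ 2 * z) := by
  constructor
  · rw [sum_range_two_mul_reflect]
    refine sum_reflect_congr _ (fun i ↦ i + 1) fun i hi ↦ ?_
    have := mem_range.1 hi
    exact hfg _ (by omega) (by omega)
  · rw [sum_range_two_mul_even_reflect]
    refine sum_reflect_congr _ (fun i ↦ 2 * (i + 1)) fun i hi ↦ ?_
    have := mem_range.1 hi
    exact hfg _ (by omega) (by omega)

lemma one_div_three_mem (h : 3 < 2 * n + 1) : 1 / (3 : ℚ) ∈ pIntegers (2 * n + 1) :=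
  mod_cast one_div_natCast_mem_of_lt (p := 2 * n + 1) (a := 3) (by omega) h

lemma one_div_two_mem (h : 3 < 2 * n + 1) : 1 / (2 : ℚ) ∈ pIntegers (2 * n + 1) :=
  mod_cast one_div_natCast_mem_of_lt (p := 2 * n + 1) (a := 2) (by omega) (by omega)

lemma harmonicPow_two_congr (h : 3 < 2 * n + 1) : ∃ z ∈ pIntegers (2 * n + 1),
    harmonicPow 2 n = -(7 / 6) * (2 * n + 1) * harmonicPow 3 n + (2 * n + 1) ^ 2 * z := by
  obtain ⟨⟨z₁, hz₁, h₁⟩, z₂, hz₂, h₂⟩ := sum_congr_half_and_even (n := n)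
    (f := fun a ↦ 1 / (a : ℚ) ^ 2) (g := fun a ↦ 2 * (1 / (a : ℚ) ^ 3)) (fun a ha hap ↦ by
      have hpa : ((2 * n + 1 - a : ℕ) : ℚ) = 2 * n + 1 - a := by
        rw [Nat.cast_sub hap.le]; push_cast; ring
      refine ⟨(3 * a - 2 * (2 * n + 1 : ℕ)) * (1 / (a : ℚ)) ^ 3 *
        (1 / ((2 * n + 1 - a : ℕ) : ℚ)) ^ 2, ?_, ?_⟩
      · refine mul_mem (mul_mem (sub_mem ?_ ?_) (pow_mem ?_ _)) (pow_mem ?_ _)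
        · exact mod_cast natCast_mem _ (3 * a)
        · exact mod_cast natCast_mem _ (2 * (2 * n + 1))
        · exact one_div_natCast_mem_of_lt ha hap
        · exact one_div_natCast_mem_of_lt (by omega) (by omega)
      · have h0 : (a : ℚ) ≠ 0 := by positivity
        have h1 : 2 * (n : ℚ) + 1 - a ≠ 0 := by
          rw [← hpa, Nat.cast_ne_zero]
          omega
        rw [hpa]
        push_cast
        field_simp
        ring)
  refine ⟨2 * (1 / 3) * (z₂ - z₁), mul_mem (mul_mem (natCast_mem _ 2) (one_div_three_mem h))
    (sub_mem hz₂ hz₁), ?_⟩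
  have e2 : ∑ i ∈ range n, 1 / ((2 * (i + 1) : ℕ) : ℚ) ^ 2 = 1 / 4 * harmonicPow 2 n := by
    rw [harmonicPow, mul_sum]
    refine sum_congr rfl fun i _ ↦ ?_
    push_cast
    field_simp
    ring
  have e3 : ∑ i ∈ range n, 2 * (1 / ((2 * (i + 1) : ℕ) : ℚ) ^ 3) = 1 / 4 * harmonicPow 3 n := by
    rw [harmonicPow, mul_sum]
    refine sum_congr rfl fun i _ ↦ ?_
    push_cast
    field_simp
    ring
  have e2' : ∑ i ∈ range n, 1 / ((i + 1 : ℕ) : ℚ) ^ 2 = harmonicPow 2 n := by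
    simp [harmonicPow]
  have e3' : ∑ i ∈ range n, 2 * (1 / ((i + 1 : ℕ) : ℚ) ^ 3) = 2 * harmonicPow 3 n := by
    simp [harmonicPow, mul_sum]
  simp only [e2', e3'] at h₁
  simp only [e2, e3] at h₂
  linear_combination (2 / 3) * (h₂ - h₁)

lemma exists_add_pow_eq (a b : ℤ) (m : ℕ) :
    ∃ z : ℤ, (a + b) ^ (m + 1) = a ^ (m + 1) + (m + 1) * b * a ^ m + b ^ 2 * z := by
  induction m with
  | zero => exact ⟨0, by simp⟩
  | succ m ih =>
    obtain ⟨z, hz⟩ := ih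
    refine ⟨z * (a + b) + (m + 1) * a ^ m, ?_⟩
    rw [pow_succ, hz]
    push_cast
    ring

lemma exists_pow_eq_one_add {p : ℕ} [Fact p.Prime] {a : ℕ} (h : ¬ p ∣ a) :
    ∃ z : ℤ, (a : ℚ) ^ (p - 1) = 1 + p * z := by
  have hc : IsCoprime (a : ℤ) p := by
    rw [Nat.isCoprime_iff_coprime]
    exact ((Nat.Prime.coprime_iff_not_dvd Fact.out).2 h).symm
  obtain ⟨z, hz⟩ := (Int.ModEq.pow_card_sub_one_eq_one Fact.out hc).symm.dvd
  refine ⟨z, ?_⟩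
  have : (a : ℤ) ^ (p - 1) = 1 + p * z := by linear_combination hz
  exact_mod_cast this

lemma sum_pow_congr (h : 3 < 2 * n + 1) : ∃ z ∈ pIntegers (2 * n + 1),
    ∑ i ∈ range n, ((i : ℚ) + 1) ^ (2 * n - 3) =
      -2 * bernoulli (2 * n - 2) + (2 * n + 1) * z := by
  obtain ⟨l, rfl⟩ : ∃ l, n = l + 2 := ⟨n - 2, by omega⟩
  rw [show 2 * (l + 2) - 3 = 2 * l + 1 by omega, show 2 * (l + 2) - 2 = 2 * l + 1 + 1 by omega]
  obtain ⟨⟨z₁, hz₁, h₁⟩, z₂, hz₂, h₂⟩ := sum_congr_half_and_even (n := l + 2)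
    (f := fun a ↦ (a : ℚ) ^ (2 * l + 1 + 1)) (g := fun a ↦ 3 * (a : ℚ) ^ (2 * l + 1))
    (fun a ha hap ↦ by
      obtain ⟨z, hz⟩ := exists_add_pow_eq (-(a : ℤ)) (2 * (l + 2) + 1) (2 * l + 1)
      refine ⟨((z - a ^ (2 * l + 1) : ℤ) : ℚ), intCast_mem _ _, ?_⟩
      have hpa : ((2 * (l + 2) + 1 - a : ℕ) : ℤ) = -a + (2 * (l + 2) + 1) := by
        rw [Nat.cast_sub hap.le]; push_cast; ring
      have he : (-(a : ℤ)) ^ (2 * l + 1 + 1) = a ^ (2 * l + 1 + 1) :=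
        Even.neg_pow ⟨l + 1, by ring⟩ _
      have ho : (-(a : ℤ)) ^ (2 * l + 1) = -a ^ (2 * l + 1) := Odd.neg_pow ⟨l, rfl⟩ _
      have hz' : ((2 * (l + 2) + 1 - a : ℕ) : ℤ) ^ (2 * l + 1 + 1) = a ^ (2 * l + 1 + 1) +
          (2 * (l + 2) + 1) * (3 * a ^ (2 * l + 1)) +
          (2 * (l + 2) + 1) ^ 2 * (z - a ^ (2 * l + 1)) := by
        rw [hpa, hz, he, ho]
        push_cast
        ring
      push_cast
      exact_mod_cast hz')
  obtain ⟨z₃, hz₃, h₃⟩ := sum_pow_sub_bernoulli (p := 2 * (l + 2) + 1) (m := 2 * l + 1 + 1)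
    (by omega)
  obtain ⟨q, hq⟩ := exists_pow_eq_one_add (p := 2 * (l + 2) + 1) (a := 2)
    (Nat.not_dvd_of_pos_of_lt (by omega) (by omega))
  have hB : bernoulli (2 * l + 1 + 1) ∈ pIntegers (2 * (l + 2) + 1) :=
    bernoulli_mem_pIntegers (by omega)
  rw [sum_range_succ'] at h₃
  simp only [Nat.cast_zero, zero_pow (Nat.succ_ne_zero _), add_zero] at h₃
  rw [h₃] at h₁ h₂
  simp only [Nat.cast_mul 2, mul_pow, ← mul_sum, Nat.cast_ofNat] at h₁ h₂
  rw [show 2 * (l + 2) + 1 - 1 = 2 * l + 4 by omega, Nat.cast_ofNat] at hq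
  push_cast at h₁ h₂ hq ⊢
  have hC : ∑ i ∈ range (l + 2), ((i : ℚ) + 1) ^ (2 * l + 1) ∈ pIntegers (2 * (l + 2) + 1) :=
    sum_mem fun i _ ↦ pow_mem (mod_cast natCast_mem _ (i + 1)) _
  generalize ∑ i ∈ range (l + 2), ((i : ℚ) + 1) ^ (2 * l + 1) = C at *
  generalize ∑ i ∈ range (l + 2), ((i : ℚ) + 1) ^ (2 * l + 1 + 1) = A at *
  generalize bernoulli (2 * l + 1 + 1) = B at *
  have hP : 2 * ((l : ℚ) + 2) + 1 ∈ pIntegers (2 * (l + 2) + 1) :=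
    mod_cast natCast_mem _ (2 * (l + 2) + 1)
  have hP0 : 2 * ((l : ℚ) + 2) + 1 ≠ 0 := by positivity
  generalize 2 * ((l : ℚ) + 2) + 1 = P at *
  have hA : A = P * (1 / 2 * (B + P * z₃ - 3 * C - P * z₁)) := by linear_combination (-1 / 2) * h₁
  have hA' : 1 / 2 * (B + P * z₃ - 3 * C - P * z₁) ∈ pIntegers (2 * (l + 2) + 1) :=
    mul_mem (one_div_two_mem h) (sub_mem (sub_mem (add_mem hB (mul_mem hP hz₃))
      (mul_mem (natCast_mem _ 3) hC)) (mul_mem hP hz₁))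
  generalize 1 / 2 * (B + P * z₃ - 3 * C - P * z₁) = A' at *
  refine ⟨1 / 3 * (4 * q * A' + 3 * q * C + 8 * z₂ - 2 * z₁ - 6 * z₃), ?_, ?_⟩
  · refine mul_mem (one_div_three_mem h) (sub_mem (sub_mem (add_mem (add_mem (mul_mem (mul_mem
      (natCast_mem _ 4) (intCast_mem _ _)) hA') (mul_mem (mul_mem (natCast_mem _ 3)
      (intCast_mem _ _)) hC)) (mul_mem (natCast_mem _ 8) hz₂)) (mul_mem (natCast_mem _ 2) hz₁))
      (mul_mem (natCast_mem _ 6) hz₃))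
  · refine mul_left_cancel₀ hP0 ?_
    have hq₁ : (2 : ℚ) ^ (2 * l + 1 + 1) = (1 + P * q) / 4 := by rw [← hq]; ring
    have hq₂ : (2 : ℚ) ^ (2 * l + 1) = (1 + P * q) / 8 := by rw [← hq]; ring
    rw [hq₁, hq₂] at h₂
    linear_combination (8 / 3) * h₂ - (2 / 3) * h₁ + (4 / 3) * P * q * hA

lemma harmonicPow_three_congr (h : 3 < 2 * n + 1) : ∃ z ∈ pIntegers (2 * n + 1),
    harmonicPow 3 n = -2 * bernoulli (2 * n - 2) + (2 * n + 1) * z := by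
  obtain ⟨z, hz, hC⟩ := sum_pow_congr h
  have hterm : ∀ i ∈ range n, ∃ w ∈ pIntegers (2 * n + 1),
      1 / ((i : ℚ) + 1) ^ 3 = ((i : ℚ) + 1) ^ (2 * n - 3) + (2 * n + 1) * w := fun i hi ↦ by
    have hin := mem_range.1 hi
    obtain ⟨q, hq⟩ := exists_pow_eq_one_add (p := 2 * n + 1) (a := i + 1)
      (Nat.not_dvd_of_pos_of_lt (by omega) (by omega))
    refine ⟨-(q * (1 / ((i + 1 : ℕ) : ℚ)) ^ 3), neg_mem (mul_mem (intCast_mem _ _)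
      (pow_mem (one_div_natCast_mem_of_lt (by omega) (by omega)) _)), ?_⟩
    rw [show 2 * n + 1 - 1 = 2 * n - 3 + 3 by omega, pow_add] at hq
    push_cast at hq ⊢
    have : (i : ℚ) + 1 ≠ 0 := by positivity
    field_simp
    linear_combination -hq
  choose! w hw hterm using hterm
  refine ⟨z + ∑ i ∈ range n, w i, add_mem hz (sum_mem hw), ?_⟩
  rw [harmonicPow, sum_congr rfl hterm, sum_add_distrib, hC, ← mul_sum]
  ring

lemma exists_prod_one_sub_eq {p : ℕ} [Fact p.Prime] (t : ℚ) (ht : t ∈ pIntegers p) {x : ℕ → ℚ}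
    {k : ℕ} (hx : ∀ j < k, x j ∈ pIntegers p) : ∃ z ∈ pIntegers p,
      ∏ j ∈ range k, (1 - t * x j) = 1 - t * ∑ j ∈ range k, x j + t ^ 2 * z := by
  induction k with
  | zero => exact ⟨0, zero_mem _, by simp⟩
  | succ k ih =>
    obtain ⟨z, hz, h⟩ := ih fun j hj ↦ hx j (by omega)
    have hk := hx k (by omega)
    refine ⟨z * (1 - t * x k) + x k * ∑ j ∈ range k, x j, add_mem (mul_mem hz (sub_mem (one_mem _)
      (mul_mem ht hk))) (mul_mem hk (sum_mem fun j hj ↦ hx j ?_)), ?_⟩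
    · have := mem_range.1 hj
      omega
    · rw [prod_range_succ, sum_range_succ, h]
      ring

lemma legendreCoeff_mem {p : ℕ} [Fact p.Prime] (m k : ℕ) : legendreCoeff m k ∈ pIntegers p :=
  mul_mem (mul_mem (pow_mem (neg_mem (one_mem _)) _) (natCast_mem _ _)) (natCast_mem _ _)

lemma sum_odd_mul_apT_congr (h : 3 < 2 * n + 1) : ∃ z ∈ pIntegers (2 * n + 1),
    ∑ k ∈ range (2 * n + 1), (2 * (k : ℚ) + 1) * (apT k : ℚ) / 4 ^ k =
      (2 * n + 1) + (2 * n + 1) ^ 3 / 2 * harmonicPow 2 n + (2 * n + 1) ^ 5 * z := by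
  have hP : 2 * (n : ℚ) + 1 ∈ pIntegers (2 * n + 1) := mod_cast natCast_mem _ (2 * n + 1)
  have hprod : ∀ k ∈ range (n + 1), ∃ z ∈ pIntegers (2 * n + 1),
      ∏ j ∈ range k, (1 - (2 * (n : ℚ) + 1) ^ 2 * (1 / (4 * ((j : ℚ) + 1) ^ 2))) =
        1 - (2 * (n : ℚ) + 1) ^ 2 * (1 / 4 * harmonicPow 2 k) + (2 * n + 1) ^ 4 * z := by
    intro k hk
    have hkn := mem_range.1 hk
    obtain ⟨z, hz, hz'⟩ := exists_prod_one_sub_eq ((2 * (n : ℚ) + 1) ^ 2) (pow_mem hP 2)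
      (x := fun j ↦ 1 / (4 * ((j : ℚ) + 1) ^ 2)) (k := k) fun j hj ↦ by
        have : 1 / (4 * ((j : ℚ) + 1) ^ 2) = (1 / 2 * (1 / ((j + 1 : ℕ) : ℚ))) ^ 2 := by
          push_cast
          field_simp
          ring
        rw [this]
        exact pow_mem (mul_mem (one_div_two_mem h)
          (one_div_natCast_mem_of_lt (by omega) (by omega))) 2
    refine ⟨z, hz, ?_⟩
    have hsum : ∑ j ∈ range k, 1 / (4 * ((j : ℚ) + 1) ^ 2) = 1 / 4 * harmonicPow 2 k := by
      rw [harmonicPow, mul_sum]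
      exact sum_congr rfl fun j _ ↦ by field_simp
    rw [hz', hsum]
    ring
  choose! z hz hprod using hprod
  refine ⟨∑ k ∈ range (n + 1), legendreCoeff n k * ((2 * n + 1) / (2 * k + 1)) * z k,
    sum_mem fun k hk ↦ mul_mem (mul_mem (legendreCoeff_mem n k) ?_) (hz k hk), ?_⟩
  · have hkn := mem_range.1 hk
    rcases (show k ≤ n by omega).eq_or_lt with rfl | hlt
    · rw [div_self (by positivity)]
      exact one_mem _
    · have := mul_mem hP (one_div_natCast_mem_of_lt (p := 2 * n + 1) (a := 2 * k + 1)
        (by omega) (by omega))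
      rw [mul_one_div] at this
      exact_mod_cast this
  · have h1 := sum_legendreCoeff_div n
    have h2 := sum_legendreCoeff_div_mul_harmonicPow n
    have hsplit : ∑ k ∈ range (n + 1), legendreCoeff n k / (2 * k + 1) *
        ∏ j ∈ range k, (1 - (2 * (n : ℚ) + 1) ^ 2 * (1 / (4 * ((j : ℚ) + 1) ^ 2))) =
        ∑ k ∈ range (n + 1), legendreCoeff n k / (2 * k + 1) -
        (2 * n + 1) ^ 2 / 4 *
          ∑ k ∈ range (n + 1), legendreCoeff n k / (2 * k + 1) * harmonicPow 2 k +
        (2 * n + 1) ^ 3 * ∑ k ∈ range (n + 1),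
          legendreCoeff n k * ((2 * n + 1) / (2 * k + 1)) * z k := by
      rw [mul_sum, mul_sum, ← sum_sub_distrib, ← sum_add_distrib]
      exact sum_congr rfl fun k hk ↦ by rw [hprod k hk]; ring
    rw [sum_odd_mul_apT, hsplit]
    linear_combination (2 * (n : ℚ) + 1) * h1 - (2 * n + 1) ^ 3 / 4 * h2

end Congruences

/-- Theorem 1.2, equation (1.6): for a prime `p > 3`,
`∑_{k=0}^{p-1} (2k+1) T_k / 4^k ≡ p + (7/6) p^4 B_{p-3} (mod p^5)` as rational numbers. -/
theorem sun_conjecture_T4 (p : ℕ) (hp : p.Prime) (hp3 : 3 < p) :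
    ((p : ℤ)) ^ 5 ∣
      ((∑ k ∈ Finset.range p, (2 * (k : ℚ) + 1) * (apT k : ℚ) / 4 ^ k) -
        ((p : ℚ) + 7 / 6 * (p : ℚ) ^ 4 * bernoulli (p - 3))).num := by
  obtain ⟨n, rfl⟩ : ∃ n, p = 2 * n + 1 := hp.odd_of_ne_two (by omega)
  have : Fact (2 * n + 1).Prime := ⟨hp⟩
  obtain ⟨z₁, hz₁, h₁⟩ := sum_odd_mul_apT_congr hp3
  obtain ⟨z₂, hz₂, h₂⟩ := harmonicPow_two_congr hp3
  obtain ⟨z₃, hz₃, h₃⟩ := harmonicPow_three_congr hp3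
  have h2 := one_div_two_mem hp3
  have h3 := one_div_three_mem hp3
  refine pow_dvd_num (y := z₁ + 1 / 2 * z₂ - 7 * (1 / 2) * (1 / 2) * (1 / 3) * z₃) ?_ ?_
  · exact sub_mem (add_mem hz₁ (mul_mem h2 hz₂))
      (mul_mem (mul_mem (mul_mem (mul_mem (natCast_mem _ 7) h2) h2) h3) hz₃)
  · rw [h₁, h₂, h₃, show 2 * n + 1 - 3 = 2 * n - 2 by omega]
    push_cast
    ring
end

section
/- For all integers n ≥ 1 and j ≥ 0, the following identity of rational numbers holds: ∑_{k=j}^{n-1} (3k+1)/4^k * binom(2k,k) * binom(k+2j,3j) = 2n(3j+1) * binom(n+2j,3j+1) * binom(2n,n) / ((2j+1) * 4^n). -/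
/-- The increment of the closed form in `n` is the summand, for `j ≤ n`. -/
lemma closed_form_succ (n j : ℕ) (h : j ≤ n) :
    2 * (n : ℚ) * (3 * (j : ℚ) + 1) * ((n + 2 * j).choose (3 * j + 1) : ℚ) *
        ((2 * n).choose n : ℚ) / ((2 * (j : ℚ) + 1) * 4 ^ n) +
      (3 * (n : ℚ) + 1) / 4 ^ n * ((2 * n).choose n : ℚ) * ((n + 2 * j).choose (3 * j) : ℚ) =
    2 * ((n + 1 : ℕ) : ℚ) * (3 * (j : ℚ) + 1) * ((n + 1 + 2 * j).choose (3 * j + 1) : ℚ) *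
        ((2 * (n + 1)).choose (n + 1) : ℚ) / ((2 * (j : ℚ) + 1) * 4 ^ (n + 1)) := by
  have h_lower : ((n + 2 * j).choose (3 * j + 1) : ℚ) * (3 * j + 1) =
      (n + 2 * j).choose (3 * j) * (n - j) := by
    have := Nat.choose_succ_right_eq (n + 2 * j) (3 * j)
    rw [show n + 2 * j - 3 * j = n - j by omega] at this
    rw [← Nat.cast_sub h]
    exact_mod_cast this
  have h_both : ((n + 1 + 2 * j).choose (3 * j + 1) : ℚ) * (3 * j + 1) =
      (n + 1 + 2 * j) * (n + 2 * j).choose (3 * j) := by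
    have := Nat.add_one_mul_choose_eq (n + 2 * j) (3 * j)
    rw [show n + 2 * j + 1 = n + 1 + 2 * j by omega] at this
    exact_mod_cast this.symm
  have h_central : ((n : ℚ) + 1) * (2 * (n + 1)).choose (n + 1) =
      2 * (2 * n + 1) * (2 * n).choose n := by
    exact_mod_cast Nat.succ_mul_centralBinom_succ n
  have hj : (2 * (j : ℚ) + 1) ≠ 0 := by positivity
  push_cast
  generalize ((2 * (n + 1)).choose (n + 1) : ℚ) = A' at *
  generalize ((2 * n).choose n : ℚ) = A at *
  generalize ((n + 1 + 2 * j).choose (3 * j + 1) : ℚ) = C' at *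
  generalize ((n + 2 * j).choose (3 * j + 1) : ℚ) = D at *
  generalize ((n + 2 * j).choose (3 * j) : ℚ) = C at *
  rw [show 2 * (n : ℚ) * (3 * j + 1) * D * A = 2 * n * A * (D * (3 * j + 1)) by ring, h_lower,
    show 2 * ((n : ℚ) + 1) * (3 * j + 1) * C' * A' =
      2 * ((n + 1) * A') * (C' * (3 * j + 1)) by ring, h_both, h_central, pow_succ]
  field_simp
  ring

/-- The identity (2.2): for `n ≥ 1` and `j ≥ 0`,
`∑_{k=j}^{n-1} (3k+1)/4^k C(2k,k) C(k+2j,3j)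
  = 2n(3j+1) C(n+2j,3j+1) C(2n,n) / ((2j+1) 4^n)`. -/
theorem identity_3k1 (n j : ℕ) (hn : 1 ≤ n) :
    ∑ k ∈ Finset.Ico j n,
        (3 * (k : ℚ) + 1) / 4 ^ k * ((2 * k).choose k : ℚ) * ((k + 2 * j).choose (3 * j) : ℚ) =
      2 * (n : ℚ) * (3 * (j : ℚ) + 1) * ((n + 2 * j).choose (3 * j + 1) : ℚ) *
        ((2 * n).choose n : ℚ) / ((2 * (j : ℚ) + 1) * 4 ^ n) := by
  clear hn
  rcases le_total n j with h | h
  · rw [Finset.Ico_eq_empty_of_le h, Nat.choose_eq_zero_of_lt (show n + 2 * j < 3 * j + 1 by omega)]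
    simp
  · induction n, h using Nat.le_induction with
    | base =>
      rw [Finset.Ico_self, Nat.choose_eq_zero_of_lt (show j + 2 * j < 3 * j + 1 by omega)]
      simp
    | succ n h ih => rw [Finset.sum_Ico_succ_top h, ih, closed_form_succ n j h]
end

section
/- For any positive integer n, ∑_{j=0}^{n-1} binom(n,j) * (-1)^j * (H_{2j} − H_j)/(2j+1) = (4^n / (2(2n+1) * binom(2n,n))) * ∑_{k=1}^{n} binom(2k,k)/(k * 4^k) + (-1)^n * H_n/(2n+1) − 4^n * H_n/(2(2n+1) * binom(2n,n)) − (-1)^n * H_{2n}/(2n+1), as an identity of rational numbers. -/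
open Finset

/-- The alternating binomial transform `∑_{j=0}^n C(n,j) (-1)^j f j`. -/
def altBinomSum (f : ℕ → ℚ) (n : ℕ) : ℚ :=
  ∑ j ∈ range (n + 1), (n.choose j : ℚ) * (-1) ^ j * f j

lemma altBinomSum_eq_sum_range_add_two (f : ℕ → ℚ) (n : ℕ) :
    altBinomSum f n = ∑ j ∈ range (n + 2), (n.choose j : ℚ) * (-1) ^ j * f j := by
  rw [sum_range_succ _ (n + 1), Nat.choose_succ_self]
  simp [altBinomSum]

/-- The transform of `f` at `n + 1` is minus the transform of the forward difference at `n`. -/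
lemma altBinomSum_succ (f : ℕ → ℚ) (n : ℕ) :
    altBinomSum f (n + 1) = -altBinomSum (fun j => f (j + 1) - f j) n := by
  have hshift : altBinomSum f n =
      ∑ j ∈ range (n + 1), (n.choose (j + 1) : ℚ) * (-1) ^ (j + 1) * f (j + 1) + f 0 := by
    rw [altBinomSum_eq_sum_range_add_two, sum_range_succ']
    simp
  have hdiff : altBinomSum (fun j => f (j + 1) - f j) n =
      altBinomSum (fun j => f (j + 1)) n - altBinomSum f n := by
    simp only [altBinomSum, mul_sub, sum_sub_distrib]
  rw [hdiff, hshift, altBinomSum, altBinomSum, sum_range_succ', neg_sub, add_sub_right_comm,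
    ← sum_sub_distrib]
  simp only [Nat.choose_zero_right, Nat.cast_one, pow_zero, one_mul, add_left_inj]
  refine sum_congr rfl fun j _ => ?_
  rw [Nat.choose_succ_succ]
  push_cast
  ring

lemma altBinomSum_div_two_mul_add_one_succ (f : ℕ → ℚ) (n : ℕ) :
    (2 * (n : ℚ) + 3) * altBinomSum (fun j => f j / (2 * (j : ℚ) + 1)) (n + 1) =
      (2 * (n : ℚ) + 2) * altBinomSum (fun j => f j / (2 * (j : ℚ) + 1)) n +
        altBinomSum f (n + 1) := by
  rw [altBinomSum_eq_sum_range_add_two _ n]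
  simp only [altBinomSum, mul_sum]
  rw [← sum_add_distrib]
  refine sum_congr rfl fun j hj => ?_
  have hle : j ≤ n + 1 := Nat.lt_succ_iff.mp (mem_range.mp hj)
  have hchoose : (n.choose j : ℚ) * (n + 1) = ((n + 1).choose j : ℚ) * (n + 1 - j) := by
    have h := congrArg (Nat.cast : ℕ → ℚ) (Nat.choose_mul_succ_eq n j)
    push_cast [Nat.cast_sub hle] at h
    exact h
  have hj0 : (2 * (j : ℚ) + 1) ≠ 0 := by positivity
  field_simp
  linear_combination (-2 * f j) * hchoose

lemma altBinomSum_inv_succ (n : ℕ) :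
    altBinomSum (fun j => 1 / ((j : ℚ) + 1)) n = 1 / ((n : ℚ) + 1) := by
  have hzero : altBinomSum (fun _ => 1) (n + 1) = 0 := by
    rw [altBinomSum_succ]
    simp [altBinomSum]
  rw [altBinomSum, sum_range_succ'] at hzero
  simp only [Nat.choose_zero_right, Nat.cast_one, pow_zero, mul_one] at hzero
  rw [eq_div_iff (by positivity), ← sub_eq_zero, ← neg_eq_zero, ← hzero, altBinomSum, sum_mul,
    neg_sub, sub_eq_neg_add, ← sum_neg_distrib, add_left_inj]
  refine sum_congr rfl fun j _ => ?_
  have hchoose : ((n : ℚ) + 1) * n.choose j = (n + 1).choose (j + 1) * ((j : ℚ) + 1) := by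
    exact_mod_cast Nat.add_one_mul_choose_eq n j
  field_simp
  linear_combination (-(-1) ^ j) * hchoose

lemma cast_centralBinom_succ (n : ℕ) :
    ((n + 1).centralBinom : ℚ) = 2 * (2 * n + 1) * n.centralBinom / (n + 1) := by
  rw [eq_div_iff (by positivity), mul_comm]
  exact_mod_cast Nat.succ_mul_centralBinom_succ n

lemma altBinomSum_inv_two_mul_add_one (n : ℕ) :
    altBinomSum (fun j => 1 / (2 * (j : ℚ) + 1)) n =
      4 ^ n / ((2 * (n : ℚ) + 1) * n.centralBinom) := by
  induction n with
  | zero => simp [altBinomSum]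
  | succ n ih =>
    have hrec := altBinomSum_div_two_mul_add_one_succ (fun _ => 1) n
    have hzero : altBinomSum (fun _ => 1) (n + 1) = 0 := by
      rw [altBinomSum_succ]
      simp [altBinomSum]
    rw [ih, hzero, add_zero] at hrec
    have h3 : (2 * (n : ℚ) + 3) ≠ 0 := by positivity
    have hc : (n.centralBinom : ℚ) ≠ 0 := by exact_mod_cast n.centralBinom_ne_zero
    apply mul_left_cancel₀ h3
    rw [hrec, cast_centralBinom_succ]
    push_cast
    rw [show 2 * ((n : ℚ) + 1) + 1 = 2 * n + 3 by ring]
    field_simp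
    ring

lemma altBinomSum_harmonic_sub_succ (n : ℕ) :
    altBinomSum (fun j => harmonic (2 * j) - harmonic j) (n + 1) =
      1 / (2 * ((n : ℚ) + 1)) - 4 ^ n / ((2 * (n : ℚ) + 1) * n.centralBinom) := by
  have hdiff : (fun j : ℕ => harmonic (2 * (j + 1)) - harmonic (j + 1) -
      (harmonic (2 * j) - harmonic j)) =
      fun j : ℕ => 1 / (2 * (j : ℚ) + 1) - 1 / 2 * (1 / ((j : ℚ) + 1)) := by
    funext j
    rw [show 2 * (j + 1) = 2 * j + 1 + 1 by ring]
    simp only [harmonic_succ]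
    push_cast
    rw [show 2 * (j : ℚ) + 1 + 1 = 2 * (j + 1) by ring]
    field_simp
    ring
  have hlin : altBinomSum (fun j : ℕ => 1 / (2 * (j : ℚ) + 1) - 1 / 2 * (1 / ((j : ℚ) + 1))) n =
      altBinomSum (fun j => 1 / (2 * (j : ℚ) + 1)) n -
        1 / 2 * altBinomSum (fun j => 1 / ((j : ℚ) + 1)) n := by
    simp only [altBinomSum, mul_sum, ← sum_sub_distrib]
    exact sum_congr rfl fun j _ => by ring
  rw [altBinomSum_succ, hdiff, hlin, altBinomSum_inv_succ, altBinomSum_inv_two_mul_add_one]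
  field_simp
  ring

lemma altBinomSum_harmonic_sub_div (n : ℕ) :
    altBinomSum (fun j => (harmonic (2 * j) - harmonic j) / (2 * (j : ℚ) + 1)) n =
      4 ^ n / (2 * (2 * (n : ℚ) + 1) * n.centralBinom) *
        (∑ k ∈ Icc 1 n, (k.centralBinom : ℚ) / ((k : ℚ) * 4 ^ k) - harmonic n) := by
  induction n with
  | zero => simp [altBinomSum]
  | succ n ih =>
    have hrec := altBinomSum_div_two_mul_add_one_succ (fun j => harmonic (2 * j) - harmonic j) n
    rw [ih, altBinomSum_harmonic_sub_succ] at hrec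
    have h3 : (2 * (n : ℚ) + 3) ≠ 0 := by positivity
    have hc : (n.centralBinom : ℚ) ≠ 0 := by exact_mod_cast n.centralBinom_ne_zero
    apply mul_left_cancel₀ h3
    rw [hrec, sum_Icc_succ_top (by lia), harmonic_succ, cast_centralBinom_succ]
    push_cast
    rw [show 2 * ((n : ℚ) + 1) + 1 = 2 * n + 3 by ring]
    generalize ∑ k ∈ Icc 1 n, (k.centralBinom : ℚ) / ((k : ℚ) * 4 ^ k) = s
    field_simp
    ring


/-- Lemma 2.1: for any positive integer `n`,
`∑_{j=0}^{n-1} C(n,j) (-1)^j (H_{2j} - H_j)/(2j+1)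
  = 4^n/(2(2n+1) C(2n,n)) ∑_{k=1}^n C(2k,k)/(k 4^k) + (-1)^n H_n/(2n+1)
    - 4^n H_n/(2(2n+1) C(2n,n)) - (-1)^n H_{2n}/(2n+1)`. -/
theorem sigma_identity (n : ℕ) (hn : 0 < n) :
    ∑ j ∈ Finset.range n,
        (n.choose j : ℚ) * (-1) ^ j * (harmonic (2 * j) - harmonic j) / (2 * (j : ℚ) + 1) =
      4 ^ n / (2 * (2 * (n : ℚ) + 1) * ((2 * n).choose n : ℚ)) *
          ∑ k ∈ Finset.Icc 1 n, ((2 * k).choose k : ℚ) / ((k : ℚ) * 4 ^ k) +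
        (-1) ^ n * harmonic n / (2 * (n : ℚ) + 1) -
        4 ^ n * harmonic n / (2 * (2 * (n : ℚ) + 1) * ((2 * n).choose n : ℚ)) -
        (-1) ^ n * harmonic (2 * n) / (2 * (n : ℚ) + 1) := by
  have h := altBinomSum_harmonic_sub_div n
  simp only [altBinomSum, sum_range_succ, Nat.choose_self, Nat.cast_one,
    Nat.centralBinom_eq_two_mul_choose, ← mul_div_assoc] at h
  linear_combination h
end

section
/- Let p > 2 be a prime and let j be an integer with 0 ≤ j ≤ (p−3)/2. Then (3j+1) * binom(3j,j) * binom(p+2j,3j+1) ≡ p * (-1)^j * (1 + p*H_{2j} − p*H_j) modulo p^3, where the congruence is understood in the rational numbers. -/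
/-- The Taylor expansion of `∏_{k=1}^{n} (x + k)` to second order in `x`; the linear coefficient
is `n! H_n`. -/
theorem prod_add_expansion (x : ℤ) (n : ℕ) : ∃ a b : ℤ,
    (a : ℚ) = n.factorial * harmonic n ∧
      ∏ k ∈ Finset.range n, (x + (k + 1)) = n.factorial + x * a + x ^ 2 * b := by
  induction n with
  | zero => exact ⟨0, 0, by simp, by simp⟩
  | succ n ih =>
    obtain ⟨a, b, ha, hb⟩ := ih
    refine ⟨n.factorial + (n + 1) * a, a + b * (n + 1) + x * b, ?_, ?_⟩
    · have hn : (n : ℚ) + 1 ≠ 0 := by positivity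
      rw [harmonic_succ, Nat.factorial_succ]
      push_cast
      rw [ha]
      field_simp
      ring
    · rw [Finset.prod_range_succ, hb, Nat.factorial_succ]
      push_cast
      ring

/-- Clearing denominators: the product of binomials as a product of `p + k` and `p - k`. -/
theorem choose_mul_choose_mul_factorials (p j : ℕ) (hj : j < p) :
    ((3 * j + 1) * (3 * j).choose j * (p + 2 * j).choose (3 * j + 1) *
        ((2 * j).factorial * j.factorial) : ℤ) =
      p * (∏ k ∈ Finset.range (2 * j), ((p : ℤ) + (k + 1))) *
        ((-1) ^ j * ∏ k ∈ Finset.range j, (-(p : ℤ) + (k + 1))) := by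
  have hdesc : ((-1) ^ j * ∏ k ∈ Finset.range j, (-(p : ℤ) + (k + 1))) =
      ((p - 1).descFactorial j : ℤ) := by
    rw [Nat.descFactorial_eq_prod_range, Nat.cast_prod]
    nth_rewrite 1 [← Finset.card_range j]
    rw [← Finset.prod_const, ← Finset.prod_mul_distrib]
    refine Finset.prod_congr rfl fun k hk => ?_
    have := Finset.mem_range.mp hk
    rw [show p - 1 - k = p - (k + 1) by omega, Nat.cast_sub (by omega)]
    push_cast
    ring
  have hasc : (∏ k ∈ Finset.range (2 * j), ((p : ℤ) + (k + 1))) =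
      ((p + 1).ascFactorial (2 * j) : ℤ) := by
    rw [Nat.ascFactorial_eq_prod_range, Nat.cast_prod]
    refine Finset.prod_congr rfl fun k _ => ?_
    push_cast
    ring
  rw [hdesc, hasc]
  norm_cast
  have h1 := Nat.choose_mul_factorial_mul_factorial (show j ≤ 3 * j by omega)
  have h2 := Nat.choose_mul_factorial_mul_factorial (show 3 * j + 1 ≤ p + 2 * j by omega)
  have h3 := Nat.factorial_mul_ascFactorial p (2 * j)
  have h4 := Nat.factorial_mul_descFactorial (show j ≤ p - 1 by omega)
  have h5 := Nat.mul_factorial_pred (show p ≠ 0 by omega)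
  rw [show 3 * j - j = 2 * j by omega] at h1
  rw [show p + 2 * j - (3 * j + 1) = p - 1 - j by omega, Nat.factorial_succ, ← h1, ← h3, ← h5,
    ← h4] at h2
  refine Nat.eq_of_mul_eq_mul_right (Nat.factorial_pos (p - 1 - j)) ?_
  linear_combination h2

theorem Rat.dvd_num_of_mul_eq {q : ℚ} {m d c : ℤ} (hd : IsCoprime m d) (h : q * d = m * c) :
    m ∣ q.num := by
  refine hd.dvd_of_dvd_mul_right ⟨c * q.den, ?_⟩
  have : (q.num * d : ℚ) = m * (c * q.den) := by
    rw [← Rat.mul_den_eq_num q]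
    linear_combination (q.den : ℚ) * h
  exact_mod_cast this

/-- Lemma 2.2, first part: for a prime `p > 2` and `0 ≤ j ≤ (p-3)/2`,
`(3j+1) C(3j,j) C(p+2j,3j+1) ≡ p (-1)^j (1 + p H_{2j} - p H_j) (mod p^3)`
as rational numbers. -/
theorem lemma_p2j_first (p : ℕ) (hp : p.Prime) (hp2 : 2 < p) (j : ℕ) (hj : j ≤ (p - 3) / 2) :
    ((p : ℤ)) ^ 3 ∣
      (((3 * (j : ℚ) + 1) * ((3 * j).choose j : ℚ) * ((p + 2 * j).choose (3 * j + 1) : ℚ)) -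
        (p : ℚ) * (-1) ^ j * (1 + (p : ℚ) * harmonic (2 * j) - (p : ℚ) * harmonic j)).num := by
  obtain ⟨a, b, ha, hab⟩ := prod_add_expansion p (2 * j)
  obtain ⟨c, d, hc, hcd⟩ := prod_add_expansion (-p) j
  have key := choose_mul_choose_mul_factorials p j (by omega)
  rw [hab, hcd] at key
  have hcop : IsCoprime ((p : ℤ) ^ 3) (((2 * j).factorial * j.factorial : ℕ) : ℤ) := by
    refine IsCoprime.pow_left (Nat.isCoprime_iff_coprime.mpr (Nat.Coprime.mul_right ?_ ?_)) <;>
      exact (Nat.coprime_factorial_iff hp.ne_one).mpr (by rw [hp.minFac_eq]; omega)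
  refine Rat.dvd_num_of_mul_eq hcop (c := (-1) ^ j *
    ((2 * j).factorial * d - a * c + b * j.factorial + p * (a * d - b * c) + p ^ 2 * b * d)) ?_
  have keyQ := congrArg (Int.cast : ℤ → ℚ) key
  push_cast at keyQ ⊢
  linear_combination keyQ + (p : ℚ) ^ 2 * (-1) ^ j * (j.factorial * ha - (2 * j).factorial * hc)
end
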